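/- arXiv:1804.07128 — 14 statements merged into one kernel-verified Lean document; each statement's English description precedes it below -/
import Mathlib

section
/- Let 1 ≤ k < n be natural numbers, let A ⊆ ℝⁿ be any set, and let Φ : A → ℝᵏ be a map such that for every x ∈ A one has lim_{r→0⁺} sup { |Φ(y) − Φ(x)| / |y − x|^{n/k} : y ∈ A ∩ B(x,r), y ≠ x } = 0. Then the k-dimensional Hausdorff measure of the image is zero: H^k(Φ(A)) = 0. -/
open MeasureTheory Metric Set

/-- An arbitrary set `S` can be cut into countably many pieces of small diameter, so a map which is
Hölder of exponent `r` at scale `< δ` on `S` satisfies the same bound on the Hausdorff measure of its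
image as a map which is globally Hölder on `S`. -/
theorem hausdorffMeasure_image_le_of_local_holder {X Y : Type*} [MetricSpace X]
    [SecondCountableTopology X] [MeasurableSpace X] [BorelSpace X] [MetricSpace Y]
    [MeasurableSpace Y] [BorelSpace Y] {f : X → Y} {S : Set X} {C r : NNReal} (hr : 0 < r)
    {d δ : ℝ} (hd : 0 ≤ d) (hδ : 0 < δ)
    (h : ∀ x ∈ S, ∀ y ∈ S, dist x y < δ → edist (f x) (f y) ≤ C * edist x y ^ (r : ℝ)) :
    μH[d] (f '' S) ≤ (C : ENNReal) ^ d * μH[(r : ℝ) * d] S := by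
  rcases isEmpty_or_nonempty X with hX | hX
  · simp [Set.eq_empty_of_isEmpty S]
  set B : ℕ → Set X := fun i => ball (TopologicalSpace.denseSeq X i) (δ / 2)
  have hcov : ⋃ i, disjointed B i = univ := by
    rw [iUnion_disjointed, eq_univ_iff_forall]
    intro x
    obtain ⟨i, hi⟩ := (TopologicalSpace.denseRange_denseSeq X).exists_dist_lt x (half_pos hδ)
    exact mem_iUnion.2 ⟨i, hi⟩
  have hmeas : ∀ i, MeasurableSet (disjointed B i) :=
    MeasurableSet.disjointed fun i => measurableSet_ball
  have hpiece : ∀ i, μH[d] (f '' (disjointed B i ∩ S)) ≤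
      (C : ENNReal) ^ d * μH[(r : ℝ) * d] (disjointed B i ∩ S) := by
    intro i
    refine HolderOnWith.hausdorffMeasure_image_le (fun x hx y hy => ?_) hr hd
    refine h x hx.2 y hy.2 ?_
    have hxB : dist x _ < δ / 2 := disjointed_subset B i hx.1
    have hyB : dist y _ < δ / 2 := disjointed_subset B i hy.1
    linarith [dist_triangle_right x y (TopologicalSpace.denseSeq X i)]
  calc μH[d] (f '' S) = μH[d] (⋃ i, f '' (disjointed B i ∩ S)) := by
        rw [← image_iUnion, ← iUnion_inter, hcov, univ_inter]
    _ ≤ ∑' i, μH[d] (f '' (disjointed B i ∩ S)) := measure_iUnion_le _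
    _ ≤ ∑' i, (C : ENNReal) ^ d * μH[(r : ℝ) * d] (disjointed B i ∩ S) :=
        ENNReal.tsum_le_tsum hpiece
    _ = (C : ENNReal) ^ d * μH[(r : ℝ) * d] S := by
        rw [ENNReal.tsum_mul_left]
        congr 1
        simp_rw [← fun i => Measure.restrict_apply (μ := μH[(r : ℝ) * d]) (t := disjointed B i)
          (s := S) (hmeas i)]
        rw [← measure_iUnion (disjoint_disjointed B) hmeas, hcov, Measure.restrict_apply_univ]

/-- If `Φ : A → ℝᵏ` (with `A ⊆ ℝⁿ`, `1 ≤ k < n`) satisfies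
`lim_{r→0⁺} sup_{y ∈ A ∩ B(x,r), y ≠ x} |Φ(y) − Φ(x)|/|y − x|^{n/k} = 0` at every `x ∈ A`,
then `H^k(Φ(A)) = 0`. -/
theorem stmt_0 {n k : ℕ} (hk : 1 ≤ k) (hkn : k < n)
    (A : Set (EuclideanSpace ℝ (Fin n)))
    (Φ : EuclideanSpace ℝ (Fin n) → EuclideanSpace ℝ (Fin k))
    (hΦ : ∀ x ∈ A, ∀ ε : ℝ, 0 < ε → ∃ r : ℝ, 0 < r ∧
      ∀ y ∈ A ∩ ball x r, y ≠ x →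
        ‖Φ y - Φ x‖ ≤ ε * ‖y - x‖ ^ ((n : ℝ) / (k : ℝ))) :
    μH[(k : ℝ)] (Φ '' A) = 0 := by
  have hk0 : (0 : ℝ) < k := by exact_mod_cast hk
  have hn0 : (0 : ℝ) < n := by exact_mod_cast (by omega : 0 < n)
  set q : NNReal := (n : NNReal) / k with hq
  have hqR : (q : ℝ) = (n : ℝ) / k := by simp [hq]
  have hq0 : 0 < q := by rw [← NNReal.coe_pos, hqR]; positivity
  have hqk : (q : ℝ) * k = n := by rw [hqR]; field_simp
  -- the Hausdorff measure of dimension `n` is a Haar measure on the source space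
  have hfin : ∀ R : ℝ, μH[(n : ℝ)] (ball (0 : EuclideanSpace ℝ (Fin n)) R) ≠ ⊤ := by
    intro R
    have := MeasureTheory.isAddHaarMeasure_hausdorffMeasure (E := EuclideanSpace ℝ (Fin n))
    rw [finrank_euclideanSpace_fin] at this
    exact measure_ball_lt_top.ne
  have hbound : ∀ (R : ℕ) (ε : NNReal), 0 < ε → μH[(k : ℝ)] (Φ '' (A ∩ ball 0 R)) ≤
      (ε : ENNReal) ^ (k : ℝ) * μH[(n : ℝ)] (ball (0 : EuclideanSpace ℝ (Fin n)) R) := by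
    intro R ε hε
    set S : ℕ → Set (EuclideanSpace ℝ (Fin n)) := fun j =>
      {x ∈ A ∩ ball 0 R | ∀ y ∈ A, dist y x < 1 / ((j : ℝ) + 1) →
        ‖Φ y - Φ x‖ ≤ ε * ‖y - x‖ ^ ((n : ℝ) / (k : ℝ))}
    have hmono : Monotone fun j => Φ '' S j := by
      intro i j hij
      refine image_mono fun x hx => ⟨hx.1, fun y hy hd => hx.2 y hy (hd.trans_le ?_)⟩
      exact Nat.one_div_le_one_div hij
    have hUnion : A ∩ ball 0 (R : ℝ) = ⋃ j, S j := by
      ext x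
      refine ⟨fun hx => ?_, fun hx => ?_⟩
      · obtain ⟨r, hr, h⟩ := hΦ x hx.1 ε hε
        obtain ⟨j, hj⟩ := exists_nat_one_div_lt hr
        refine mem_iUnion.2 ⟨j, hx, fun y hy hd => ?_⟩
        rcases eq_or_ne y x with rfl | hne
        · simp only [sub_self, norm_zero]; positivity
        · exact h y ⟨hy, hd.trans hj⟩ hne
      · obtain ⟨j, hj⟩ := mem_iUnion.1 hx
        exact hj.1
    rw [hUnion, image_iUnion, hmono.measure_iUnion]
    refine iSup_le fun j => ?_
    refine (hausdorffMeasure_image_le_of_local_holder hq0 (C := ε) hk0.le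
      (Nat.one_div_pos_of_nat (n := j)) fun x hx y hy hd => ?_).trans ?_
    · have h := hy.2 x hx.1.1 hd
      rw [← dist_eq_norm, ← dist_eq_norm, ← hqR] at h
      rw [edist_dist, edist_dist, ENNReal.ofReal_rpow_of_nonneg dist_nonneg q.coe_nonneg,
        ← ENNReal.ofReal_coe_nnreal, ← ENNReal.ofReal_mul ε.coe_nonneg]
      exact ENNReal.ofReal_le_ofReal h
    · rw [hqk]
      gcongr
      exact fun x hx => hx.1.2
  have hzero : ∀ R : ℕ, μH[(k : ℝ)] (Φ '' (A ∩ ball 0 R)) = 0 := by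
    intro R
    refine le_antisymm (ge_of_tendsto (f := fun j : ℕ => (((1 / ((j : NNReal) + 1) : NNReal) :
      ENNReal) ^ (k : ℝ) * μH[(n : ℝ)] (ball (0 : EuclideanSpace ℝ (Fin n)) R)))
      (x := Filter.atTop) ?_ (Filter.Eventually.of_forall fun j => hbound R _ (by positivity)))
      zero_le
    have h1 : Filter.Tendsto (fun j : ℕ => ((1 / ((j : NNReal) + 1) : NNReal) : ENNReal))
        Filter.atTop (nhds 0) := by
      rw [← ENNReal.coe_zero]
      exact ENNReal.tendsto_coe.2 (tendsto_one_div_add_atTop_nhds_zero_nat (𝕜 := NNReal))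
    have h2 := ENNReal.Tendsto.mul_const (h1.ennrpow_const (k : ℝ)) (Or.inr (hfin R))
    rwa [ENNReal.zero_rpow_of_pos hk0, zero_mul] at h2
  have hA : Φ '' A = ⋃ R : ℕ, Φ '' (A ∩ ball 0 R) := by
    rw [← image_iUnion, ← inter_iUnion, iUnion_ball_nat, inter_univ]
  rw [hA]
  exact measure_iUnion_null hzero
end

section
/- Let φ : (0,∞) → (0,∞) be monotone nondecreasing and let C : (0,∞) → (0,∞) be a nondecreasing function such that φ(2r) ≤ C(R)·φ(r) for every R > 0 and every 0 < r < R. Define ψ(r) := ∫_0^∞ φ(√t)⁻¹ exp(−r²/t) dt ∈ [0,∞]. Then there exists a nondecreasing function Λ : (0,∞) → (0,∞), whose values depend only on the function C, such that Λ(R)⁻¹ · ∫_r^∞ s/φ(s) ds ≤ ψ(r) ≤ Λ(R) · ∫_r^∞ s/φ(s) ds for every R > 0 and every 0 < r < R. Moreover, if the function C can be taken to be a constant, then Λ can be taken to be a constant as well. -/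
open MeasureTheory Set

/-- Iterated doubling, with the number of doublings bounded linearly in `r / u`. -/
lemma le_exp_mul_of_doubling {φ : ℝ → ℝ} {c r u : ℝ} (hc : 0 < c)
    (hpos : ∀ r : ℝ, 0 < r → 0 < φ r)
    (hmono : ∀ r s : ℝ, 0 < r → r ≤ s → φ r ≤ φ s)
    (hdouble : ∀ u : ℝ, 0 < u → u ≤ r → φ (2 * u) ≤ c * φ u)
    (hu : 0 < u) (hur : u ≤ r) :
    φ r ≤ Real.exp (c * (r / u + 1)) * φ u := by
  have iter : ∀ n : ℕ, ∀ u : ℝ, 0 < u → u ≤ r → r ≤ 2 ^ n * u →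
      φ r ≤ Real.exp (c * n) * φ u := by
    intro n
    induction n with
    | zero =>
      intro u hu hur hru
      have : r = u := le_antisymm (by simpa using hru) hur
      simp [this]
    | succ n ih =>
      intro u hu hur hru
      have hexp : Real.exp (c * (n + 1 : ℕ)) = Real.exp (c * n) * Real.exp c := by
        rw [← Real.exp_add]; push_cast; ring_nf
      have hstep : φ (2 * u) ≤ Real.exp c * φ u :=
        (hdouble u hu hur).trans
          (mul_le_mul_of_nonneg_right (by linarith [Real.add_one_le_exp c]) (hpos u hu).le)
      rw [hexp, mul_assoc]
      rcases le_total (2 * u) r with h | h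
      · exact (ih (2 * u) (by positivity) h (by rw [pow_succ] at hru; linarith)).trans
          (mul_le_mul_of_nonneg_left hstep (Real.exp_pos _).le)
      · have h1 : 1 ≤ Real.exp (c * n) := Real.one_le_exp (by positivity)
        have h2 : φ r ≤ Real.exp c * φ u := (hmono r _ (hu.trans_le hur) h).trans hstep
        have h3 : 0 < Real.exp c * φ u := mul_pos (Real.exp_pos _) (hpos u hu)
        nlinarith
  have hru : 0 ≤ r / u := div_nonneg (hu.le.trans hur) hu.le
  have hceil : r / u ≤ 2 ^ ⌈r / u⌉₊ :=
    (Nat.le_ceil _).trans (by exact_mod_cast Nat.lt_two_pow_self.le)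
  refine (iter ⌈r / u⌉₊ u hu hur ((div_le_iff₀ hu).1 hceil)).trans
    (mul_le_mul_of_nonneg_right (Real.exp_le_exp.2 ?_) (hpos u hu).le)
  exact mul_le_mul_of_nonneg_left (Nat.ceil_lt_add_one hru).le hc.le

lemma exp_neg_sq_div_div_le {φ : ℝ → ℝ} {c r t : ℝ} (hc : 0 < c) (hr : 0 < r)
    (hpos : ∀ r : ℝ, 0 < r → 0 < φ r)
    (hmono : ∀ r s : ℝ, 0 < r → r ≤ s → φ r ≤ φ s)
    (hdouble : ∀ u : ℝ, 0 < u → u ≤ r → φ (2 * u) ≤ c * φ u)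
    (ht : 0 < t) (htr : t ≤ r ^ 2) :
    Real.exp (-(r ^ 2) / t) / φ (Real.sqrt t) ≤ Real.exp (c + c ^ 2) / φ r := by
  set u := Real.sqrt t with hu_def
  have hu : 0 < u := Real.sqrt_pos.2 ht
  have hur : u ≤ r := Real.sqrt_le_iff.2 ⟨hr.le, htr⟩
  have htu : t = u ^ 2 := (Real.sq_sqrt ht.le).symm
  have hdiv : -(r ^ 2) / t = -(r / u) ^ 2 := by rw [htu, div_pow, neg_div]
  rw [div_le_div_iff₀ (hpos u hu) (hpos r hr), hdiv]
  calc Real.exp (-(r / u) ^ 2) * φ r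
      ≤ Real.exp (-(r / u) ^ 2) * (Real.exp (c * (r / u + 1)) * φ u) :=
        mul_le_mul_of_nonneg_left (le_exp_mul_of_doubling hc hpos hmono hdouble hu hur)
          (Real.exp_pos _).le
    _ = Real.exp (-(r / u) ^ 2 + c * (r / u + 1)) * φ u := by rw [Real.exp_add, mul_assoc]
    _ ≤ Real.exp (c + c ^ 2) * φ u :=
        mul_le_mul_of_nonneg_right
          (Real.exp_le_exp.2 (by nlinarith [sq_nonneg (r / u - c / 2), sq_nonneg c]))
          (hpos u hu).le

lemma lintegral_Ioi_sq (g : ℝ → ENNReal) {r : ℝ} (hr : 0 < r) :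
    ∫⁻ t in Ioi (r ^ 2), g t = ∫⁻ u in Ioi r, ENNReal.ofReal (2 * u) * g (u ^ 2) := by
  have himage : (fun u : ℝ => u ^ 2) '' Ioi r = Ioi (r ^ 2) := by
    ext t
    constructor
    · rintro ⟨u, hu, rfl⟩
      exact pow_lt_pow_left₀ hu hr.le two_ne_zero
    · intro ht
      have ht' : r ^ 2 < t := ht
      exact ⟨Real.sqrt t, Real.lt_sqrt hr.le |>.2 ht',
        Real.sq_sqrt ((sq_nonneg r).trans ht'.le)⟩
  have hinj : InjOn (fun u : ℝ => u ^ 2) (Ioi r) := fun a ha b hb hab =>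
    (pow_left_inj₀ (hr.trans ha).le (hr.trans hb).le two_ne_zero).1 hab
  have hderiv : ∀ u ∈ Ioi r, HasDerivWithinAt (fun u : ℝ => u ^ 2) (2 * u) (Ioi r) u :=
    fun u _ => by simpa using (hasDerivAt_pow 2 u).hasDerivWithinAt
  rw [← himage, lintegral_image_eq_lintegral_abs_deriv_mul measurableSet_Ioi hderiv hinj]
  refine setLIntegral_congr_fun measurableSet_Ioi fun u hu => ?_
  have : 0 < u := hr.trans hu
  simp only [abs_of_pos (mul_pos two_pos this)]

lemma lintegral_exp_div_Ioi_sq {φ : ℝ → ℝ} {r : ℝ} (hr : 0 < r) :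
    ∫⁻ t in Ioi (r ^ 2), ENNReal.ofReal (Real.exp (-(r ^ 2) / t) / φ (Real.sqrt t)) =
      ∫⁻ u in Ioi r, ENNReal.ofReal (2 * Real.exp (-(r ^ 2) / u ^ 2) * (u / φ u)) := by
  rw [lintegral_Ioi_sq _ hr]
  refine setLIntegral_congr_fun measurableSet_Ioi fun u hu => ?_
  have : 0 < u := hr.trans hu
  simp only [Real.sqrt_sq this.le]
  rw [← ENNReal.ofReal_mul (by positivity)]
  congr 1
  ring

lemma ofReal_sq_div_le_lintegral {φ : ℝ → ℝ} {c r : ℝ} (hc : 0 < c) (hr : 0 < r)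
    (hpos : ∀ r : ℝ, 0 < r → 0 < φ r)
    (hmono : ∀ r s : ℝ, 0 < r → r ≤ s → φ r ≤ φ s)
    (hdouble : φ (2 * r) ≤ c * φ r) :
    ENNReal.ofReal (r ^ 2 / (c * φ r)) ≤ ∫⁻ s in Ioi r, ENNReal.ofReal (s / φ s) := by
  have hφ : 0 < φ r := hpos r hr
  calc ENNReal.ofReal (r ^ 2 / (c * φ r))
      = ∫⁻ _ in Ioc r (2 * r), ENNReal.ofReal (r / (c * φ r)) := by
        rw [setLIntegral_const, Real.volume_Ioc, ← ENNReal.ofReal_mul (by positivity)]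
        congr 1
        ring
    _ ≤ ∫⁻ s in Ioc r (2 * r), ENNReal.ofReal (s / φ s) := by
        refine setLIntegral_mono' measurableSet_Ioc fun s hs => ENNReal.ofReal_le_ofReal ?_
        have hs0 : 0 < s := hr.trans hs.1
        exact div_le_div₀ hs0.le hs.1.le (hpos s hs0) ((hmono s _ hs0 hs.2).trans hdouble)
    _ ≤ ∫⁻ s in Ioi r, ENNReal.ofReal (s / φ s) := lintegral_mono_set Ioc_subset_Ioi_self

lemma lintegral_exp_div_comparable {φ : ℝ → ℝ} {c r : ℝ} (hc : 0 < c) (hr : 0 < r)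
    (hpos : ∀ r : ℝ, 0 < r → 0 < φ r)
    (hmono : ∀ r s : ℝ, 0 < r → r ≤ s → φ r ≤ φ s)
    (hdouble : ∀ u : ℝ, 0 < u → u ≤ r → φ (2 * u) ≤ c * φ u) :
    ENNReal.ofReal (2 + c * Real.exp (c + c ^ 2))⁻¹ *
        (∫⁻ s in Ioi r, ENNReal.ofReal (s / φ s)) ≤
      (∫⁻ t in Ioi (0 : ℝ), ENNReal.ofReal (Real.exp (-(r ^ 2) / t) / φ (Real.sqrt t))) ∧
    (∫⁻ t in Ioi (0 : ℝ), ENNReal.ofReal (Real.exp (-(r ^ 2) / t) / φ (Real.sqrt t))) ≤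
      ENNReal.ofReal (2 + c * Real.exp (c + c ^ 2)) *
        ∫⁻ s in Ioi r, ENNReal.ofReal (s / φ s) := by
  have hK : 0 < c * Real.exp (c + c ^ 2) := by positivity
  constructor
  · calc ENNReal.ofReal (2 + c * Real.exp (c + c ^ 2))⁻¹ *
          (∫⁻ s in Ioi r, ENNReal.ofReal (s / φ s))
        = ∫⁻ s in Ioi r, ENNReal.ofReal ((2 + c * Real.exp (c + c ^ 2))⁻¹ * (s / φ s)) := by
          simp only [ENNReal.ofReal_mul (show 0 ≤ (2 + c * Real.exp (c + c ^ 2))⁻¹ by positivity)]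
          rw [lintegral_const_mul' _ _ ENNReal.ofReal_ne_top]
      _ ≤ ∫⁻ u in Ioi r, ENNReal.ofReal (2 * Real.exp (-(r ^ 2) / u ^ 2) * (u / φ u)) := by
          refine setLIntegral_mono' measurableSet_Ioi fun u hu => ENNReal.ofReal_le_ofReal ?_
          have hu0 : 0 < u := hr.trans hu
          refine mul_le_mul_of_nonneg_right ?_ (div_nonneg hu0.le (hpos u hu0).le)
          have hquot : r ^ 2 / u ^ 2 ≤ 1 :=
            (div_le_one (by positivity)).2 (pow_le_pow_left₀ hr.le (le_of_lt hu) 2)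
          have hexp : (Real.exp 1)⁻¹ ≤ Real.exp (-(r ^ 2) / u ^ 2) := by
            rw [← Real.exp_neg, neg_div]
            exact Real.exp_le_exp.2 (neg_le_neg hquot)
          have hthird : (3 : ℝ)⁻¹ ≤ (Real.exp 1)⁻¹ :=
            inv_anti₀ (Real.exp_pos 1) (by linarith [Real.exp_one_lt_d9])
          have hhalf : (2 + c * Real.exp (c + c ^ 2))⁻¹ ≤ (2 : ℝ)⁻¹ :=
            inv_anti₀ two_pos (by linarith)
          linarith
      _ = ∫⁻ t in Ioi (r ^ 2),
            ENNReal.ofReal (Real.exp (-(r ^ 2) / t) / φ (Real.sqrt t)) :=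
          (lintegral_exp_div_Ioi_sq hr).symm
      _ ≤ _ := lintegral_mono_set (Ioi_subset_Ioi (sq_nonneg r))
  · have hfar : ∫⁻ t in Ioi (r ^ 2),
          ENNReal.ofReal (Real.exp (-(r ^ 2) / t) / φ (Real.sqrt t)) ≤
        ENNReal.ofReal 2 * ∫⁻ s in Ioi r, ENNReal.ofReal (s / φ s) := by
      rw [lintegral_exp_div_Ioi_sq hr, ← lintegral_const_mul' _ _ ENNReal.ofReal_ne_top]
      refine setLIntegral_mono' measurableSet_Ioi fun u hu => ?_
      have hu0 : 0 < u := hr.trans hu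
      rw [← ENNReal.ofReal_mul zero_le_two]
      refine ENNReal.ofReal_le_ofReal
        (mul_le_mul_of_nonneg_right ?_ (div_nonneg hu0.le (hpos u hu0).le))
      have : Real.exp (-(r ^ 2) / u ^ 2) ≤ 1 :=
        Real.exp_le_one_iff.2 (div_nonpos_of_nonpos_of_nonneg (by simp [sq_nonneg]) (sq_nonneg u))
      linarith
    have hnear : ∫⁻ t in Ioc 0 (r ^ 2),
          ENNReal.ofReal (Real.exp (-(r ^ 2) / t) / φ (Real.sqrt t)) ≤
        ENNReal.ofReal (c * Real.exp (c + c ^ 2)) *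
          ∫⁻ s in Ioi r, ENNReal.ofReal (s / φ s) := by
      have hφ : 0 < φ r := hpos r hr
      calc _ ≤ ∫⁻ _ in Ioc 0 (r ^ 2), ENNReal.ofReal (Real.exp (c + c ^ 2) / φ r) :=
            setLIntegral_mono' measurableSet_Ioc fun t ht => ENNReal.ofReal_le_ofReal
              (exp_neg_sq_div_div_le hc hr hpos hmono hdouble ht.1 ht.2)
        _ = ENNReal.ofReal (c * Real.exp (c + c ^ 2)) *
              ENNReal.ofReal (r ^ 2 / (c * φ r)) := by
            rw [setLIntegral_const, Real.volume_Ioc, ← ENNReal.ofReal_mul (by positivity),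
              ← ENNReal.ofReal_mul hK.le]
            congr 1
            field_simp
            ring
        _ ≤ _ := by
            gcongr
            exact ofReal_sq_div_le_lintegral hc hr hpos hmono (hdouble r hr le_rfl)
    rw [← Ioc_union_Ioi_eq_Ioi (sq_nonneg r),
      lintegral_union measurableSet_Ioi (Ioc_disjoint_Ioi le_rfl),
      ENNReal.ofReal_add zero_le_two hK.le, add_mul, add_comm]
    exact add_le_add hfar hnear

/-- For a nondecreasing `φ : (0,∞) → (0,∞)` satisfying a local doubling property with
function `C`, the function `ψ(r) = ∫_0^∞ φ(√t)⁻¹ e^{−r²/t} dt` is comparable, for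
`0 < r < R`, to `∫_r^∞ s/φ(s) ds` with a nondecreasing comparison function `Λ` depending
only on `C`; if `C` is constant, `Λ` can be taken constant. -/
theorem stmt_2 :
    (∀ C : ℝ → ℝ, (∀ R : ℝ, 0 < R → 0 < C R) →
      (∀ R S : ℝ, 0 < R → R ≤ S → C R ≤ C S) →
      ∃ Λ : ℝ → ℝ, (∀ R : ℝ, 0 < R → 0 < Λ R) ∧
        (∀ R S : ℝ, 0 < R → R ≤ S → Λ R ≤ Λ S) ∧
        ∀ φ : ℝ → ℝ, (∀ r : ℝ, 0 < r → 0 < φ r) →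
          (∀ r s : ℝ, 0 < r → r ≤ s → φ r ≤ φ s) →
          (∀ R r : ℝ, 0 < r → r < R → φ (2 * r) ≤ C R * φ r) →
          ∀ R r : ℝ, 0 < r → r < R →
            ENNReal.ofReal (Λ R)⁻¹ *
                (∫⁻ s in Set.Ioi r, ENNReal.ofReal (s / φ s)) ≤
              (∫⁻ t in Set.Ioi (0 : ℝ),
                ENNReal.ofReal (Real.exp (-(r ^ 2) / t) / φ (Real.sqrt t))) ∧
            (∫⁻ t in Set.Ioi (0 : ℝ),
                ENNReal.ofReal (Real.exp (-(r ^ 2) / t) / φ (Real.sqrt t))) ≤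
              ENNReal.ofReal (Λ R) *
                ∫⁻ s in Set.Ioi r, ENNReal.ofReal (s / φ s)) ∧
    (∀ c : ℝ, 0 < c →
      ∃ Λ₀ : ℝ, 0 < Λ₀ ∧
        ∀ φ : ℝ → ℝ, (∀ r : ℝ, 0 < r → 0 < φ r) →
          (∀ r s : ℝ, 0 < r → r ≤ s → φ r ≤ φ s) →
          (∀ r : ℝ, 0 < r → φ (2 * r) ≤ c * φ r) →
          ∀ r : ℝ, 0 < r →
            ENNReal.ofReal Λ₀⁻¹ *
                (∫⁻ s in Set.Ioi r, ENNReal.ofReal (s / φ s)) ≤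
              (∫⁻ t in Set.Ioi (0 : ℝ),
                ENNReal.ofReal (Real.exp (-(r ^ 2) / t) / φ (Real.sqrt t))) ∧
            (∫⁻ t in Set.Ioi (0 : ℝ),
                ENNReal.ofReal (Real.exp (-(r ^ 2) / t) / φ (Real.sqrt t))) ≤
              ENNReal.ofReal Λ₀ *
                ∫⁻ s in Set.Ioi r, ENNReal.ofReal (s / φ s)) := by
  constructor
  · intro C hC hCmono
    refine ⟨fun R => 2 + C R * Real.exp (C R + C R ^ 2), fun R hR => ?_, fun R S hR hRS => ?_, ?_⟩
    · have := hC R hR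
      positivity
    · have h := hCmono R S hR hRS
      have hR' := hC R hR
      have hS' := hC S (hR.trans_le hRS)
      dsimp only
      gcongr
    · intro φ hpos hmono hdouble R r hr hrR
      exact lintegral_exp_div_comparable (hC R (hr.trans hrR)) hr hpos hmono
        fun u hu hur => hdouble R u hu (hur.trans_lt hrR)
  · intro c hc
    exact ⟨2 + c * Real.exp (c + c ^ 2), by positivity, fun φ hpos hmono hdouble r hr =>
      lintegral_exp_div_comparable hc hr hpos hmono fun u hu _ => hdouble u hu⟩
end

section
/- Let (X,d) be a metric space and μ a Borel measure on X with 0 < μ(B(x,r)) < ∞ for every x ∈ X and r > 0. Assume that μ is doubling with constant C_D and that μ is non-parabolic. Then there exists a constant C > 0, depending only on C_D, such that for every Borel function f : X → [0,∞] and all x, y ∈ X with x ≠ y it holds ∫_X f(w) · H(x,d(x,w)) · H(y,d(y,w)) dμ(w) ≤ C · ( F(x,d(x,y)) + F(y,d(x,y)) ) · ( Mf(x) + Mf(y) ), the inequality being understood in [0,∞]. -/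
open MeasureTheory Metric Set
open scoped ENNReal

section Auxiliary

variable {X : Type*} [MetricSpace X] [MeasurableSpace X] {μ : Measure X}

/-- A measure that is finite on all balls around some point is σ-finite. -/
theorem sigmaFinite_of_measure_ball_lt_top (x : X) (h : ∀ r : ℝ, 0 < r → μ (ball x r) < ⊤) :
    SigmaFinite μ := by
  refine ⟨⟨⟨fun n => ball x (n + 1), fun _ => trivial, fun n => h _ (by positivity), ?_⟩⟩⟩
  refine iUnion_eq_univ_iff.2 fun w => ?_
  obtain ⟨n, hn⟩ := exists_nat_gt (dist w x)
  exact ⟨n, mem_ball.2 (by linarith)⟩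

theorem measurable_one_div_measure_ball (μ : Measure X) (x : X) :
    Measurable fun s : ℝ => 1 / μ (ball x s) :=
  measurable_const.div
    (Monotone.measurable fun _ _ h => measure_mono (ball_subset_ball h))

/-- Doubling allows the lower endpoint of `∫ s / μ(B(y,s)) ds` to be halved. -/
theorem lintegral_Ioi_half_le {K : ℝ≥0∞} (y : X) {d : ℝ} (hd : 0 < d)
    (hdoub : ∀ r : ℝ, 0 < r → μ (ball y (2 * r)) ≤ K * μ (ball y r))
    (hK : K ≠ 0) (hK' : K ≠ ⊤) :
    ∫⁻ t in Ioi (d / 2), ENNReal.ofReal t / μ (ball y t) ≤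
      K * ∫⁻ s in Ioi d, ENNReal.ofReal s / μ (ball y s) := by
  have himg : (fun t : ℝ => 2 * t) '' Ioi (d / 2) = Ioi d := by
    rw [image_mul_left_Ioi two_pos]
    congr 1
    ring
  rw [← himg, lintegral_image_eq_lintegral_abs_deriv_mul measurableSet_Ioi
    (f' := fun _ => 2) (fun t _ => by simpa using ((hasDerivAt_id t).const_mul 2).hasDerivWithinAt)
    (fun a _ b _ h => by simpa using h), ← lintegral_const_mul' _ _ hK']
  refine setLIntegral_mono' measurableSet_Ioi fun t ht => ?_
  have ht0 : 0 < t := lt_trans (by positivity) (mem_Ioi.1 ht)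
  calc ENNReal.ofReal t / μ (ball y t)
      = K * (ENNReal.ofReal t * (K * μ (ball y t))⁻¹) := by
        rw [ENNReal.mul_inv (Or.inl hK) (Or.inl hK'), mul_left_comm (ENNReal.ofReal t),
          ← mul_assoc K, ENNReal.mul_inv_cancel hK hK', one_mul, div_eq_mul_inv]
    _ ≤ K * (ENNReal.ofReal (2 * t) * (μ (ball y (2 * t)))⁻¹) := by
        gcongr
        · linarith
        · exact hdoub t ht0
    _ ≤ K * (ENNReal.ofReal |2| * (ENNReal.ofReal (2 * t) / μ (ball y (2 * t)))) := by
        rw [div_eq_mul_inv]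
        gcongr K * ?_
        exact le_mul_of_one_le_left zero_le (ENNReal.one_le_ofReal.2 (by norm_num))

/-- Integrating out the smaller of two ordered positive radii. -/
theorem lintegral_prod_indicator_Ioc_eq (b : ℝ → ℝ≥0∞) (hb : Measurable b) {c : ℝ} :
    ∫⁻ p : ℝ × ℝ, {p : ℝ × ℝ | 0 < p.1 ∧ p.1 ≤ p.2 ∧ c < p.2}.indicator (fun p => b p.2) p =
      ∫⁻ t in Ioi c, ENNReal.ofReal t * b t := by
  have hS : MeasurableSet {p : ℝ × ℝ | 0 < p.1 ∧ p.1 ≤ p.2 ∧ c < p.2} :=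
    (measurableSet_lt measurable_const measurable_fst).inter
      ((measurableSet_le measurable_fst measurable_snd).inter
        (measurableSet_lt measurable_const measurable_snd))
  rw [Measure.volume_eq_prod,
    lintegral_prod_symm' _ (show Measurable ({p : ℝ × ℝ | 0 < p.1 ∧ p.1 ≤ p.2 ∧ c < p.2}.indicator
      fun p => b p.2) from (hb.comp measurable_snd).indicator hS),
    ← lintegral_indicator measurableSet_Ioi]
  refine lintegral_congr fun t => ?_
  by_cases ht : c < t
  · have : ∀ s : ℝ, {p : ℝ × ℝ | 0 < p.1 ∧ p.1 ≤ p.2 ∧ c < p.2}.indicator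
        (fun p => b p.2) (s, t) = (Ioc 0 t).indicator (fun _ => b t) s := by
      intro s
      simp [indicator_apply, ht]
    simp_rw [this]
    rw [lintegral_indicator measurableSet_Ioc, setLIntegral_const, Real.volume_Ioc,
      indicator_of_mem (mem_Ioi.2 ht), sub_zero, mul_comm]
  · simp [ht]

/-- If `s ≤ t`, then the mass of `f` on `B(x,s) ∩ B(y,t)` is controlled by `Mf(x) * μ(B(x,s))`,
and it vanishes unless `t > d(x,y)/2`. -/
theorem setLIntegral_ball_inter_ball_le (f : X → ℝ≥0∞) (x y : X) {s t : ℝ} (hst : s ≤ t) :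
    (∫⁻ w in ball x s ∩ ball y t, f w ∂μ) * (1 / μ (ball x s) * (1 / μ (ball y t))) ≤
      (⨆ r ∈ Ioi (0 : ℝ), (μ (ball x r))⁻¹ * ∫⁻ w in ball x r, f w ∂μ) *
        {p : ℝ × ℝ | 0 < p.1 ∧ p.1 ≤ p.2 ∧ dist x y / 2 < p.2}.indicator
          (fun p => 1 / μ (ball y p.2)) (s, t) := by
  rcases le_or_gt s 0 with hs | hs
  · simp [ball_eq_empty.2 hs]
  rcases le_or_gt t (dist x y / 2) with ht | ht
  · rw [(ball_disjoint_ball (by linarith : s + t ≤ dist x y)).inter_eq]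
    simp
  rw [indicator_of_mem (show (s, t) ∈ {p : ℝ × ℝ | 0 < p.1 ∧ p.1 ≤ p.2 ∧ dist x y / 2 < p.2}
    from ⟨hs, hst, ht⟩), ← mul_assoc]
  gcongr
  refine le_trans ?_ (le_iSup₂ (f := fun r (_ : r ∈ Ioi (0 : ℝ)) =>
    (μ (ball x r))⁻¹ * ∫⁻ w in ball x r, f w ∂μ) s hs)
  rw [one_div, mul_comm]
  gcongr
  exact inter_subset_left

/-- Fubini: the product of the two tails is integrated over pairs of radii. -/
theorem lintegral_mul_tails_eq [BorelSpace X] [SFinite μ] {f : X → ℝ≥0∞} (hf : Measurable f) (x y : X) :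
    ∫⁻ w, f w * (∫⁻ s in Ioi (dist x w), 1 / μ (ball x s)) *
        (∫⁻ s in Ioi (dist y w), 1 / μ (ball y s)) ∂μ =
      ∫⁻ p : ℝ × ℝ, (∫⁻ w in ball x p.1 ∩ ball y p.2, f w ∂μ) *
        (1 / μ (ball x p.1) * (1 / μ (ball y p.2))) := by
  have ha := measurable_one_div_measure_ball μ x
  have hb := measurable_one_div_measure_ball μ y
  have hdist : ∀ z : X, Measurable fun w => dist z w := fun z =>
    (continuous_const.dist continuous_id).measurable
  set G : X → ℝ × ℝ → ℝ≥0∞ := fun w p =>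
    {q : X × ℝ × ℝ | dist x q.1 < q.2.1 ∧ dist y q.1 < q.2.2}.indicator
      (fun q => f q.1 * (1 / μ (ball x q.2.1) * (1 / μ (ball y q.2.2)))) (w, p) with hG
  have hGm : Measurable (Function.uncurry G) := by
    refine Measurable.indicator ?_ ?_
    · exact (hf.comp measurable_fst).mul ((ha.comp (measurable_fst.comp measurable_snd)).mul
        (hb.comp (measurable_snd.comp measurable_snd)))
    · exact (measurableSet_lt ((hdist x).comp measurable_fst)
        (measurable_fst.comp measurable_snd)).inter
        (measurableSet_lt ((hdist y).comp measurable_fst) (measurable_snd.comp measurable_snd))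
  trans ∫⁻ w, (∫⁻ p : ℝ × ℝ, G w p) ∂μ
  · refine lintegral_congr fun w => ?_
    rw [← lintegral_indicator measurableSet_Ioi, ← lintegral_indicator measurableSet_Ioi,
      mul_assoc, ← lintegral_prod_mul (ha.indicator measurableSet_Ioi).aemeasurable
        (hb.indicator measurableSet_Ioi).aemeasurable,
      ← lintegral_const_mul _ (by
        exact ((ha.indicator measurableSet_Ioi).comp measurable_fst).mul
          ((hb.indicator measurableSet_Ioi).comp measurable_snd)), Measure.volume_eq_prod]
    refine lintegral_congr fun p => ?_
    by_cases h1 : dist x w < p.1 <;> by_cases h2 : dist y w < p.2 <;>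
      simp [hG, indicator_apply, h1, h2]
  · rw [lintegral_lintegral_swap hGm.aemeasurable]
    refine lintegral_congr fun p => ?_
    rw [← lintegral_mul_const _ hf,
      ← lintegral_indicator (measurableSet_ball.inter measurableSet_ball)]
    refine lintegral_congr fun w => ?_
    by_cases h1 : dist x w < p.1 <;> by_cases h2 : dist y w < p.2 <;>
      simp [hG, indicator, dist_comm w, h1, h2]

end Auxiliary

/-- Scalar maximal estimate: on a doubling (constant `C_D`) non-parabolic metric measure
space, there is `C > 0` depending only on `C_D` such that for every nonnegative Borel `f`
and all `x ≠ y`,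
`∫ f(w) H(x,d(x,w)) H(y,d(y,w)) dμ(w) ≤ C (F(x,d(x,y)) + F(y,d(x,y))) (Mf(x) + Mf(y))`. -/
theorem stmt_3 (C_D : ℝ) (hC_D : 1 ≤ C_D) :
    ∃ C : ℝ, 0 < C ∧
      ∀ (X : Type) [MetricSpace X] [MeasurableSpace X] [BorelSpace X]
        (μ : Measure X),
        (∀ (x : X) (r : ℝ), 0 < r → 0 < μ (ball x r)) →
        (∀ (x : X) (r : ℝ), 0 < r → μ (ball x r) < ⊤) →
        (∀ (x : X) (r : ℝ), 0 < r →
          μ (ball x (2 * r)) ≤ ENNReal.ofReal C_D * μ (ball x r)) →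
        (∃ x₀ : X,
          (∫⁻ s in Set.Ioi (1 : ℝ), ENNReal.ofReal s / μ (ball x₀ s)) < ⊤) →
        ∀ f : X → ℝ≥0∞, Measurable f →
          ∀ x y : X, x ≠ y →
            (∫⁻ w, f w * (∫⁻ s in Set.Ioi (dist x w), 1 / μ (ball x s)) *
                (∫⁻ s in Set.Ioi (dist y w), 1 / μ (ball y s)) ∂μ) ≤
              ENNReal.ofReal C *
                ((∫⁻ s in Set.Ioi (dist x y), ENNReal.ofReal s / μ (ball x s)) +
                  ∫⁻ s in Set.Ioi (dist x y), ENNReal.ofReal s / μ (ball y s)) *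
                ((⨆ r ∈ Set.Ioi (0 : ℝ),
                    (μ (ball x r))⁻¹ * ∫⁻ w in ball x r, f w ∂μ) +
                  ⨆ r ∈ Set.Ioi (0 : ℝ),
                    (μ (ball y r))⁻¹ * ∫⁻ w in ball y r, f w ∂μ) := by
  refine ⟨C_D, by linarith, ?_⟩
  intro X _ _ _ μ _ hfin hdoub _ f hf x y hxy
  have : SigmaFinite μ := sigmaFinite_of_measure_ball_lt_top x (hfin x)
  have hd : 0 < dist x y := dist_pos.2 hxy
  have hK : ENNReal.ofReal C_D ≠ 0 := by
    simp only [ne_eq, ENNReal.ofReal_eq_zero, not_le]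
    linarith
  rw [lintegral_mul_tails_eq hf x y]
  set K := ENNReal.ofReal C_D
  set Mx := ⨆ r ∈ Ioi (0 : ℝ), (μ (ball x r))⁻¹ * ∫⁻ w in ball x r, f w ∂μ
  set My := ⨆ r ∈ Ioi (0 : ℝ), (μ (ball y r))⁻¹ * ∫⁻ w in ball y r, f w ∂μ
  set Fx := ∫⁻ s in Ioi (dist x y), ENNReal.ofReal s / μ (ball x s)
  set Fy := ∫⁻ s in Ioi (dist x y), ENNReal.ofReal s / μ (ball y s)
  set S := {p : ℝ × ℝ | 0 < p.1 ∧ p.1 ≤ p.2 ∧ dist x y / 2 < p.2} with hS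
  have hSm : MeasurableSet S :=
    (measurableSet_lt measurable_const measurable_fst).inter
      ((measurableSet_le measurable_fst measurable_snd).inter
        (measurableSet_lt measurable_const measurable_snd))
  have htail : ∀ z : X, Measurable (S.indicator fun p : ℝ × ℝ => 1 / μ (ball z p.2)) := fun z =>
    ((measurable_one_div_measure_ball μ z).comp measurable_snd).indicator hSm
  have hbound : ∀ z : X, ∫⁻ p, S.indicator (fun p : ℝ × ℝ => 1 / μ (ball z p.2)) p ≤
      K * ∫⁻ s in Ioi (dist x y), ENNReal.ofReal s / μ (ball z s) := fun z => by
    rw [lintegral_prod_indicator_Ioc_eq _ (measurable_one_div_measure_ball μ z)]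
    simpa only [mul_one_div] using
      lintegral_Ioi_half_le z hd (hdoub z) hK ENNReal.ofReal_ne_top
  calc ∫⁻ p : ℝ × ℝ, (∫⁻ w in ball x p.1 ∩ ball y p.2, f w ∂μ) *
        (1 / μ (ball x p.1) * (1 / μ (ball y p.2)))
      ≤ ∫⁻ p : ℝ × ℝ, (Mx * S.indicator (fun p => 1 / μ (ball y p.2)) p +
          My * S.indicator (fun p => 1 / μ (ball x p.2)) p.swap) := by
        refine lintegral_mono fun p => ?_
        rcases le_total p.1 p.2 with h | h
        · exact le_add_right (setLIntegral_ball_inter_ball_le f x y h)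
        · refine le_add_left ?_
          rw [inter_comm, mul_comm (1 / μ (ball x p.1)), hS, dist_comm x y]
          exact setLIntegral_ball_inter_ball_le f y x h
    _ = Mx * (∫⁻ p, S.indicator (fun p : ℝ × ℝ => 1 / μ (ball y p.2)) p) +
          My * ∫⁻ p, S.indicator (fun p : ℝ × ℝ => 1 / μ (ball x p.2)) p := by
        rw [lintegral_add_left ((htail y).const_mul Mx), lintegral_const_mul _ (htail y),
          lintegral_const_mul My (f := fun p : ℝ × ℝ =>
            S.indicator (fun p => 1 / μ (ball x p.2)) p.swap) ((htail x).comp measurable_swap),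
          Measure.volume_eq_prod, lintegral_prod_swap]
    _ ≤ Mx * (K * Fy) + My * (K * Fx) := by
        gcongr
        exacts [hbound y, hbound x]
    _ ≤ (Mx * (K * Fy) + My * (K * Fx)) + (Mx * (K * Fx) + My * (K * Fy)) := le_self_add
    _ = K * (Fx + Fy) * (Mx + My) := by ring
end

section
/- Let (X,d) be a metric space and μ a Borel measure on X with 0 < μ(B(x,r)) < ∞ for every x ∈ X and r > 0. Assume: (i) μ(B(x,R)) ≤ (R/r)^N · μ(B(x,r)) for all x ∈ X and 0 < r < R, for some N > 0; (ii) there exist c ∈ (0,1] and k > 2 with μ(B(x,R)) ≥ c·(R/r)^k · μ(B(x,r)) for all x ∈ X and 0 < r < R. Let G be a Borel symmetric kernel comparable to F with constant C₂ ≥ 1. Then there exists a constant C^G > 0, depending only on N, k, c and C₂, such that μ(B^G(x,2r)) ≤ C^G · μ(B^G(x,r)) for every x ∈ X and every r > 0. -/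
open MeasureTheory Metric Set
open scoped ENNReal

/-- If `V` grows at least like the power `k` with constant `c`, then the tail integral
`∫_ρ^∞ s / V s ds` is at most `l ^ (k - 2) / c` times the one starting at `l * ρ`. -/
theorem lintegral_Ioi_div_le_of_growth {V : ℝ → ℝ≥0∞} {k c l ρ : ℝ} (hc : 0 < c) (hl : 0 < l)
    (hl1 : l < 1) (hρ : 0 < ρ) (hpos : ∀ s, 0 < s → 0 < V s) (hfin : ∀ s, 0 < s → V s < ⊤)
    (hV : ∀ r R : ℝ, 0 < r → r < R → ENNReal.ofReal (c * (R / r) ^ k) * V r ≤ V R) :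
    ∫⁻ s in Ioi ρ, ENNReal.ofReal s / V s ≤
      ENNReal.ofReal (l ^ (k - 2) / c) * ∫⁻ s in Ioi (l * ρ), ENNReal.ofReal s / V s := by
  have himg : (fun s : ℝ => l * s) '' Ioi ρ = Ioi (l * ρ) := image_mul_left_Ioi hl ρ
  have hcov := lintegral_image_eq_lintegral_abs_deriv_mul (s := Ioi ρ) (f := fun s : ℝ => l * s)
    (f' := fun _ => l) measurableSet_Ioi
    (fun s _ => by simpa using ((hasDerivAt_id s).const_mul l).hasDerivWithinAt)
    (fun a _ b _ h => mul_left_cancel₀ hl.ne' h) (fun s => ENNReal.ofReal s / V s)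
  rw [himg] at hcov
  rw [hcov, ← lintegral_const_mul' _ _ ENNReal.ofReal_ne_top]
  refine setLIntegral_mono' measurableSet_Ioi fun s hs => ?_
  have hs0 : 0 < s := hρ.trans hs
  have hls : 0 < l * s := mul_pos hl hs0
  have h := hV (l * s) s hls (by nlinarith)
  obtain ⟨A, hA0, hA⟩ : ∃ A : ℝ, 0 < A ∧ V s = ENNReal.ofReal A :=
    ⟨(V s).toReal, ENNReal.toReal_pos (hpos s hs0).ne' (hfin s hs0).ne,
      (ENNReal.ofReal_toReal (hfin s hs0).ne).symm⟩
  obtain ⟨B, hB0, hB⟩ : ∃ B : ℝ, 0 < B ∧ V (l * s) = ENNReal.ofReal B :=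
    ⟨(V (l * s)).toReal, ENNReal.toReal_pos (hpos _ hls).ne' (hfin _ hls).ne,
      (ENNReal.ofReal_toReal (hfin _ hls).ne).symm⟩
  have hq : s / (l * s) = l⁻¹ := by field_simp
  have hlk : 0 < l ^ k := Real.rpow_pos_of_pos hl k
  rw [hA, hB, hq, Real.inv_rpow hl.le, ← ENNReal.ofReal_mul (by positivity),
    ENNReal.ofReal_le_ofReal_iff hA0.le] at h
  have hlk2 : l ^ (k - 2) = l ^ k / l ^ 2 := by
    rw [Real.rpow_sub hl, Real.rpow_two]
  rw [hA, hB, abs_of_pos hl, ← ENNReal.ofReal_div_of_pos hA0, ← ENNReal.ofReal_div_of_pos hB0,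
    ← ENNReal.ofReal_mul hl.le, ← ENNReal.ofReal_mul (by positivity), hlk2]
  refine ENNReal.ofReal_le_ofReal ?_
  have e : l ^ k / l ^ 2 / c * (l * (l * s / B)) = s * (l ^ k / (c * B)) := by
    field_simp
  rw [e, div_eq_mul_inv]
  refine mul_le_mul_of_nonneg_left ?_ hs0.le
  rw [inv_le_comm₀ hA0 (by positivity), inv_div]
  calc c * B / l ^ k = c * (l ^ k)⁻¹ * B := by ring
    _ ≤ A := h

/-- Doubling property of `μ` with respect to the `G`-balls: under two-sided volume growth
conditions (exponents `N` and `k > 2`, constant `c`), and for a symmetric kernel `G`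
comparable to `F` with constant `C₂`, there is `C^G > 0` depending only on `N, k, c, C₂`
with `μ(B^G(x,2r)) ≤ C^G μ(B^G(x,r))` for all `x` and `r > 0`. -/
theorem stmt_4 (N k c C₂ : ℝ) (hN : 0 < N) (hk : 2 < k) (hc : 0 < c) (hc1 : c ≤ 1)
    (hC₂ : 1 ≤ C₂) :
    ∃ CG : ℝ, 0 < CG ∧
      ∀ (X : Type) [MetricSpace X] [MeasurableSpace X] [BorelSpace X]
        (μ : Measure X) (G : X → X → ℝ),
        (∀ (x : X) (r : ℝ), 0 < r → 0 < μ (ball x r)) →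
        (∀ (x : X) (r : ℝ), 0 < r → μ (ball x r) < ⊤) →
        (∀ (x : X) (r R : ℝ), 0 < r → r < R →
          μ (ball x R) ≤ ENNReal.ofReal ((R / r) ^ N) * μ (ball x r)) →
        (∀ (x : X) (r R : ℝ), 0 < r → r < R →
          ENNReal.ofReal (c * (R / r) ^ k) * μ (ball x r) ≤ μ (ball x R)) →
        (∀ x y : X, x ≠ y → 0 < G x y) →
        (∀ x y : X, x ≠ y → G x y = G y x) →
        (∀ x y : X, x ≠ y →
          ENNReal.ofReal C₂⁻¹ *
              (∫⁻ s in Set.Ioi (dist x y), ENNReal.ofReal s / μ (ball x s)) ≤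
            ENNReal.ofReal (G x y) ∧
          ENNReal.ofReal (G x y) ≤
            ENNReal.ofReal C₂ *
              ∫⁻ s in Set.Ioi (dist x y), ENNReal.ofReal s / μ (ball x s)) →
        ∀ (x : X) (r : ℝ), 0 < r →
          μ (insert x {y : X | y ≠ x ∧ 1 / (2 * r) < G x y}) ≤
            ENNReal.ofReal CG * μ (insert x {y : X | y ≠ x ∧ 1 / r < G x y}) := by
  set q : ℝ := c / (2 * C₂ ^ 2) with hq
  have hC0 : 0 < C₂ := by linarith
  have hq0 : 0 < q := by positivity
  have hq1 : q < 1 := by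
    rw [hq, div_lt_one (by positivity)]
    nlinarith
  set l : ℝ := q ^ (k - 2)⁻¹ with hl_def
  have hl : 0 < l := Real.rpow_pos_of_pos hq0 _
  have hl1 : l < 1 := Real.rpow_lt_one hq0.le hq1 (inv_pos.2 (by linarith))
  have hlk : l ^ (k - 2) = q := Real.rpow_inv_rpow hq0.le (by linarith)
  have hCG : 1 ≤ (2 / l) ^ N :=
    Real.one_le_rpow (by rw [le_div_iff₀ hl]; linarith) hN.le
  refine ⟨(2 / l) ^ N, by linarith, ?_⟩
  intro X _ _ _ μ G hpos hfin hup hlow hG _ hF x r hr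
  set S : Set X := insert x {y : X | y ≠ x ∧ 1 / r < G x y} with hS
  set T : Set X := {y : X | y ≠ x ∧ 1 / (2 * r) < G x y} with hT
  have hball : ∀ y ∈ T, ball x (l * dist x y) ⊆ S := by
    rintro y ⟨hyx, hy⟩ z hz
    rcases eq_or_ne z x with rfl | hzx
    · exact mem_insert _ _
    refine Or.inr ⟨hzx, ?_⟩
    have hd : 0 < dist x y := dist_pos.2 hyx.symm
    have h1 := (hF x y hyx.symm).2
    have h2 := lintegral_Ioi_div_le_of_growth (V := fun s => μ (ball x s)) hc hl hl1 hd
      (hpos x) (hfin x) (hlow x)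
    rw [hlk] at h2
    have h3 : ∫⁻ s in Ioi (l * dist x y), ENNReal.ofReal s / μ (ball x s) ≤
        ∫⁻ s in Ioi (dist x z), ENNReal.ofReal s / μ (ball x s) :=
      lintegral_mono_set (Ioi_subset_Ioi (by rw [dist_comm]; exact (mem_ball.1 hz).le))
    have h4 : ∫⁻ s in Ioi (dist x z), ENNReal.ofReal s / μ (ball x s) ≤
        ENNReal.ofReal C₂ * ENNReal.ofReal (G x z) := by
      refine le_trans (le_of_eq ?_) (mul_le_mul_right (hF x z hzx.symm).1 (ENNReal.ofReal C₂))
      rw [← mul_assoc, ← ENNReal.ofReal_mul hC0.le, mul_inv_cancel₀ hC0.ne',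
        ENNReal.ofReal_one, one_mul]
    have h5 : ENNReal.ofReal (G x y) ≤ ENNReal.ofReal (C₂ * (q / c * (C₂ * G x z))) := by
      rw [ENNReal.ofReal_mul hC0.le, ENNReal.ofReal_mul (by positivity : 0 ≤ q / c),
        ENNReal.ofReal_mul hC0.le]
      refine h1.trans ?_
      gcongr
      refine h2.trans ?_
      gcongr
      exact h3.trans h4
    have hGz := hG x z hzx.symm
    rw [ENNReal.ofReal_le_ofReal_iff (by positivity)] at h5
    have e : C₂ * (q / c * (C₂ * G x z)) = G x z / 2 := by
      rw [hq]
      field_simp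
    have e2 : 1 / (2 * r) = 1 / r / 2 := by field_simp
    linarith
  have hle : ∀ A : Set X, A ⊆ S → μ A ≤ ENNReal.ofReal ((2 / l) ^ N) * μ S := fun A hA =>
    (measure_mono hA).trans <| le_mul_of_one_le_left' (by simpa using hCG)
  rcases T.eq_empty_or_nonempty with hTe | hTn
  · rw [hTe]
    exact hle _ (insert_subset_insert (empty_subset _))
  by_cases hb : BddAbove ((fun y => dist x y) '' T)
  · set M := sSup ((fun y => dist x y) '' T)
    have hM : ∀ y ∈ T, dist x y ≤ M := fun y hy => le_csSup hb (mem_image_of_mem _ hy)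
    have hM0 : 0 < M := by
      obtain ⟨y, hy⟩ := hTn
      exact (dist_pos.2 hy.1.symm).trans_le (hM y hy)
    obtain ⟨_, ⟨y, hy, rfl⟩, hyM⟩ := exists_lt_of_lt_csSup (hTn.image fun y => dist x y)
      (half_lt_self hM0)
    have hd : 0 < dist x y := dist_pos.2 hy.1.symm
    have hsub : insert x T ⊆ ball x (2 * dist x y) := by
      rintro z (rfl | hz)
      · exact mem_ball_self (by positivity)
      · rw [mem_ball, dist_comm]
        have := hM z hz
        simp only at hyM
        linarith
    have hd2 : 2 * dist x y / (l * dist x y) = 2 / l := by field_simp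
    have h := hup x (l * dist x y) (2 * dist x y) (by positivity) (by nlinarith)
    rw [hd2] at h
    refine (measure_mono hsub).trans (h.trans ?_)
    gcongr
    exact hball y hy
  · refine hle _ fun z _ => ?_
    rw [not_bddAbove_iff] at hb
    obtain ⟨_, ⟨y, hy, rfl⟩, hyz⟩ := hb (dist z x / l)
    refine hball y hy ?_
    rw [mem_ball, mul_comm]
    exact (div_lt_iff₀ hl).1 hyz
end

section
/- Let (X,d) be a metric space and μ a Borel measure on X with 0 < μ(B(x,r)) < ∞ for every x ∈ X and r > 0. Assume: (i) μ(B(x,R)) ≤ (R/r)^N · μ(B(x,r)) for all x ∈ X and 0 < r < R, for some N > 0; (ii) there exist c ∈ (0,1] and k > 2 with μ(B(x,R)) ≥ c·(R/r)^k · μ(B(x,r)) for all x ∈ X and 0 < r < R. Let G be a Borel symmetric kernel comparable to F with constant C₂ ≥ 1. Then there exists a constant C > 0, depending only on N, k, c and C₂, such that for every Borel function f : X → [0,∞], every x ∈ X and every r > 0 it holds μ(B^G(x,r))⁻¹ · ∫_{B^G(x,r)} f dμ ≤ C · Mf(x); in particular the maximal operator associated to the G-balls is pointwise dominated by C times the Hardy–Littlewood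 maximal operator. -/
open MeasureTheory Metric Set
open scoped ENNReal

/-- The profile `F(x, r) = ∫_r^∞ s / μ(B(x, s)) ds`. -/
noncomputable def growthProfile {X : Type*} [PseudoMetricSpace X] [MeasurableSpace X]
    (μ : Measure X) (x : X) (r : ℝ) : ℝ≥0∞ :=
  ∫⁻ s in Set.Ioi r, ENNReal.ofReal s / μ (ball x s)

lemma growthProfile_antitone {X : Type*} [PseudoMetricSpace X] [MeasurableSpace X]
    (μ : Measure X) (x : X) : Antitone (growthProfile μ x) :=
  fun _ _ h => lintegral_mono_set (Set.Ioi_subset_Ioi h)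

/-- Lower volume growth of order `k` makes the profile grow at least like `L ^ (k - 2)` when
the radius is divided by `L`. -/
lemma growthProfile_div_ge {X : Type*} [PseudoMetricSpace X] [MeasurableSpace X]
    {μ : Measure X} {x : X} {c k : ℝ} (hc : 0 < c)
    (hlow : ∀ r R : ℝ, 0 < r → r < R →
      ENNReal.ofReal (c * (R / r) ^ k) * μ (ball x r) ≤ μ (ball x R))
    {L s : ℝ} (hL : 1 < L) (hs : 0 < s) :
    ENNReal.ofReal (c * L ^ (k - 2)) * growthProfile μ x s ≤ growthProfile μ x (s / L) := by
  have hL0 : 0 < L := by linarith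
  have himg : Set.Ioi (s / L) = (fun t => L⁻¹ * t) '' Set.Ioi s := by
    rw [Set.image_mul_left_Ioi (inv_pos.2 hL0), div_eq_inv_mul]
  unfold growthProfile
  rw [himg, lintegral_image_eq_lintegral_abs_deriv_mul measurableSet_Ioi
    (f' := fun _ => L⁻¹)
    (fun t _ => by simpa using ((hasDerivAt_id t).const_mul L⁻¹).hasDerivWithinAt)
    (mul_right_injective₀ (inv_pos.2 hL0).ne').injOn,
    ← lintegral_const_mul' _ _ ENNReal.ofReal_ne_top]
  refine setLIntegral_mono' measurableSet_Ioi fun t ht => ?_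
  have ht0 : 0 < t := hs.trans ht
  have hlt : L⁻¹ * t < t := by
    rw [inv_mul_lt_iff₀ hL0]; nlinarith
  have hgrow := hlow (L⁻¹ * t) t (by positivity) hlt
  have hquot : t / (L⁻¹ * t) = L := by field_simp
  rw [hquot] at hgrow
  have hpos : 0 < c * L ^ k := by positivity
  have hinv : ENNReal.ofReal (c * L ^ k) * (μ (ball x t))⁻¹ ≤ (μ (ball x (L⁻¹ * t)))⁻¹ := by
    calc ENNReal.ofReal (c * L ^ k) * (μ (ball x t))⁻¹
        ≤ ENNReal.ofReal (c * L ^ k) *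
            (ENNReal.ofReal (c * L ^ k) * μ (ball x (L⁻¹ * t)))⁻¹ := by
          gcongr
      _ = (μ (ball x (L⁻¹ * t)))⁻¹ := by
          rw [ENNReal.mul_inv (Or.inl (ENNReal.ofReal_pos.2 hpos).ne')
            (Or.inl ENNReal.ofReal_ne_top), ← mul_assoc,
            ENNReal.mul_inv_cancel (ENNReal.ofReal_pos.2 hpos).ne' ENNReal.ofReal_ne_top, one_mul]
  have hreal : c * L ^ (k - 2) * t = |L⁻¹| * (L⁻¹ * t) * (c * L ^ k) := by
    rw [abs_of_pos (inv_pos.2 hL0), Real.rpow_sub hL0, Real.rpow_two]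
    field_simp
  calc ENNReal.ofReal (c * L ^ (k - 2)) * (ENNReal.ofReal t / μ (ball x t))
      = ENNReal.ofReal (c * L ^ (k - 2) * t) * (μ (ball x t))⁻¹ := by
        rw [ENNReal.ofReal_mul (p := c * L ^ (k - 2)) (by positivity), div_eq_mul_inv, mul_assoc]
    _ = ENNReal.ofReal |L⁻¹| * ENNReal.ofReal (L⁻¹ * t) *
          (ENNReal.ofReal (c * L ^ k) * (μ (ball x t))⁻¹) := by
        rw [hreal, ENNReal.ofReal_mul (by positivity), ENNReal.ofReal_mul (abs_nonneg _),
          mul_assoc]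
    _ ≤ ENNReal.ofReal |L⁻¹| * ENNReal.ofReal (L⁻¹ * t) * (μ (ball x (L⁻¹ * t)))⁻¹ := by
        gcongr
    _ = ENNReal.ofReal |L⁻¹| * (ENNReal.ofReal (L⁻¹ * t) / μ (ball x (L⁻¹ * t))) := by
        rw [div_eq_mul_inv, mul_assoc]

lemma exists_one_lt_lt_mul_rpow {c p : ℝ} (hc : 0 < c) (hp : 0 < p) (M : ℝ) :
    ∃ L : ℝ, 1 < L ∧ M < c * L ^ p :=
  ((Filter.eventually_gt_atTop 1).and
    (((tendsto_rpow_atTop hp).const_mul_atTop hc).eventually_gt_atTop M)).exists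

/-- Lower volume growth of positive order rules out atoms. -/
lemma measure_singleton_eq_zero_of_growth {X : Type*} [PseudoMetricSpace X] [MeasurableSpace X]
    {μ : Measure X} {x : X} {c k : ℝ} (hc : 0 < c) (hk : 0 < k)
    (hfin : μ (ball x 1) < ⊤)
    (hlow : ∀ r R : ℝ, 0 < r → r < R →
      ENNReal.ofReal (c * (R / r) ^ k) * μ (ball x r) ≤ μ (ball x R)) :
    μ {x} = 0 := by
  by_contra h0
  have hle : ∀ r : ℝ, 0 < r → μ {x} ≤ μ (ball x r) := fun r hr =>
    measure_mono (Set.singleton_subset_iff.2 (mem_ball_self hr))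
  have htop : μ {x} ≠ ⊤ := ((hle 1 one_pos).trans_lt hfin).ne
  obtain ⟨L, hL, hM⟩ := exists_one_lt_lt_mul_rpow hc hk
    ((μ (ball x 1)).toReal / (μ {x}).toReal)
  have hL0 : 0 < L := by linarith
  have hgrow := hlow L⁻¹ 1 (by positivity) (inv_lt_one_of_one_lt₀ hL)
  rw [one_div, inv_inv] at hgrow
  have hreal := ENNReal.toReal_mono hfin.ne
    ((mul_le_mul_right (hle L⁻¹ (by positivity)) _).trans hgrow)
  rw [ENNReal.toReal_mul, ENNReal.toReal_ofReal (by positivity)] at hreal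
  rw [div_lt_iff₀ (ENNReal.toReal_pos h0 htop)] at hM
  linarith

/-- A superlevel set of a kernel comparable to the profile is either a single point or
squeezed between two concentric balls whose radii have ratio `2 * L`. -/
lemma superlevel_eq_singleton_or_between_balls {X : Type*} [MetricSpace X] [MeasurableSpace X]
    {μ : Measure X} {x : X} {c k C₂ L : ℝ} {g : X → ℝ} (hc : 0 < c) (hk : 2 < k) (hC₂ : 0 < C₂)
    (hlow : ∀ r R : ℝ, 0 < r → r < R →
      ENNReal.ofReal (c * (R / r) ^ k) * μ (ball x r) ≤ μ (ball x R))
    (hg : ∀ y, x ≠ y →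
      ENNReal.ofReal C₂⁻¹ * growthProfile μ x (dist x y) ≤ ENNReal.ofReal (g y) ∧
      ENNReal.ofReal (g y) ≤ ENNReal.ofReal C₂ * growthProfile μ x (dist x y))
    (hL : 1 < L) (hLC : C₂ ^ 2 < c * L ^ (k - 2)) {a : ℝ} (ha : 0 < a) :
    insert x {y : X | y ≠ x ∧ a < g y} = {x} ∨
      ∃ s : ℝ, 0 < s ∧ ball x (s / L) ⊆ insert x {y : X | y ≠ x ∧ a < g y} ∧
        insert x {y : X | y ≠ x ∧ a < g y} ⊆ ball x (2 * s) := by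
  set S := {y : X | y ≠ x ∧ a < g y} with hS
  rcases S.eq_empty_or_nonempty with hempty | ⟨y₀, hy₀⟩
  · left; simp [hempty]
  right
  have hL0 : 0 < L := by linarith
  have hfin : ∀ y, x ≠ y → growthProfile μ x (dist x y) ≠ ⊤ := by
    intro y hy htop
    have h := (hg y hy).1
    rw [htop, ENNReal.mul_top (ENNReal.ofReal_pos.2 (inv_pos.2 hC₂)).ne'] at h
    exact ENNReal.ofReal_ne_top (top_le_iff.1 h)
  have hup : ∀ y ∈ S, a / C₂ < (growthProfile μ x (dist x y)).toReal := by
    rintro y ⟨hyx, hya⟩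
    have h := ENNReal.toReal_mono
      (ENNReal.mul_ne_top ENNReal.ofReal_ne_top (hfin y hyx.symm)) (hg y hyx.symm).2
    rw [ENNReal.toReal_mul, ENNReal.toReal_ofReal hC₂.le,
      ENNReal.toReal_ofReal (ha.trans hya).le] at h
    rw [div_lt_iff₀' hC₂]
    linarith
  have hbdd : BddAbove ((fun y => dist x y) '' S) := by
    have hd₀ : 0 < dist x y₀ := dist_pos.2 hy₀.1.symm
    obtain ⟨L', hL', hM⟩ := exists_one_lt_lt_mul_rpow hc (sub_pos.2 hk)
      ((growthProfile μ x (dist x y₀)).toReal / (a / C₂))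
    have hL'0 : 0 < L' := by linarith
    refine ⟨L' * dist x y₀, ?_⟩
    rintro _ ⟨y, hy, rfl⟩
    by_contra! hlt
    have hle : dist x y₀ ≤ dist x y / L' := by
      rw [le_div_iff₀' hL'0]; exact hlt.le
    have h := ENNReal.toReal_mono (hfin y₀ hy₀.1.symm)
      ((growthProfile_div_ge hc hlow hL' (dist_pos.2 hy.1.symm)).trans
        (growthProfile_antitone μ x hle))
    rw [ENNReal.toReal_mul, ENNReal.toReal_ofReal (by positivity)] at h
    rw [div_lt_iff₀ (by positivity)] at hM
    have := mul_lt_mul_of_pos_left (hup y hy) (show 0 < c * L' ^ (k - 2) by positivity)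
    linarith
  have hle : ∀ z ∈ S, dist x z ≤ sSup ((fun y => dist x y) '' S) := fun z hz =>
    le_csSup hbdd ⟨z, hz, rfl⟩
  have hsup : 0 < sSup ((fun y => dist x y) '' S) :=
    (dist_pos.2 hy₀.1.symm).trans_le (hle y₀ hy₀)
  obtain ⟨_, ⟨y, hy, rfl⟩, hlt⟩ := exists_lt_of_lt_csSup (Set.image_nonempty.2 ⟨y₀, hy₀⟩) (half_lt_self hsup)
  have hs : 0 < dist x y := dist_pos.2 hy.1.symm
  refine ⟨dist x y, hs, ?_, ?_⟩
  · intro z hz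
    by_cases hzx : z = x
    · exact Or.inl hzx
    refine Or.inr ⟨hzx, ?_⟩
    have hxz : x ≠ z := Ne.symm hzx
    rw [mem_ball'] at hz
    have hchain := ENNReal.toReal_mono (hfin z hxz)
      ((growthProfile_div_ge hc hlow hL hs).trans
        (growthProfile_antitone μ x hz.le))
    rw [ENNReal.toReal_mul, ENNReal.toReal_ofReal (by positivity)] at hchain
    have hkey : a * C₂ < (growthProfile μ x (dist x z)).toReal := by
      calc a * C₂ = C₂ ^ 2 * (a / C₂) := by field_simp
        _ < C₂ ^ 2 * (growthProfile μ x (dist x y)).toReal := by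
          gcongr; exact hup y hy
        _ ≤ c * L ^ (k - 2) * (growthProfile μ x (dist x y)).toReal := by gcongr
        _ ≤ _ := hchain
    have hlow' := (hg z hxz).1
    rw [← ENNReal.ofReal_toReal (hfin z hxz), ← ENNReal.ofReal_mul (inv_pos.2 hC₂).le] at hlow'
    have hpos : a < C₂⁻¹ * (growthProfile μ x (dist x z)).toReal := by
      rwa [lt_inv_mul_iff₀' hC₂]
    exact hpos.trans_le ((ENNReal.ofReal_le_ofReal_iff'.1 hlow').resolve_right
      (not_le.2 (ha.trans hpos)))
  · rintro z (rfl | hz)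
    · exact mem_ball_self (by positivity)
    · rw [mem_ball']
      linarith [hle z hz]

/-- Maximal function associated to the `G`-balls: under two-sided volume growth conditions
and for a symmetric kernel `G` comparable to `F` with constant `C₂`, there is `C > 0`
depending only on `N, k, c, C₂` with
`μ(B^G(x,r))⁻¹ ∫_{B^G(x,r)} f dμ ≤ C · Mf(x)` for all nonnegative Borel `f`, `x`, `r > 0`;
in particular the maximal operator of the `G`-balls is dominated by `C` times the
Hardy–Littlewood maximal operator. -/
theorem stmt_5 (N k c C₂ : ℝ) (hN : 0 < N) (hk : 2 < k) (hc : 0 < c) (hc1 : c ≤ 1)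
    (hC₂ : 1 ≤ C₂) :
    ∃ C : ℝ, 0 < C ∧
      ∀ (X : Type) [MetricSpace X] [MeasurableSpace X] [BorelSpace X]
        (μ : Measure X) (G : X → X → ℝ),
        (∀ (x : X) (r : ℝ), 0 < r → 0 < μ (ball x r)) →
        (∀ (x : X) (r : ℝ), 0 < r → μ (ball x r) < ⊤) →
        (∀ (x : X) (r R : ℝ), 0 < r → r < R →
          μ (ball x R) ≤ ENNReal.ofReal ((R / r) ^ N) * μ (ball x r)) →
        (∀ (x : X) (r R : ℝ), 0 < r → r < R →
          ENNReal.ofReal (c * (R / r) ^ k) * μ (ball x r) ≤ μ (ball x R)) →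
        (∀ x y : X, x ≠ y → 0 < G x y) →
        (∀ x y : X, x ≠ y → G x y = G y x) →
        (∀ x y : X, x ≠ y →
          ENNReal.ofReal C₂⁻¹ *
              (∫⁻ s in Set.Ioi (dist x y), ENNReal.ofReal s / μ (ball x s)) ≤
            ENNReal.ofReal (G x y) ∧
          ENNReal.ofReal (G x y) ≤
            ENNReal.ofReal C₂ *
              ∫⁻ s in Set.Ioi (dist x y), ENNReal.ofReal s / μ (ball x s)) →
        ∀ f : X → ℝ≥0∞, Measurable f → ∀ x : X,
          (∀ r : ℝ, 0 < r →
            (μ (insert x {y : X | y ≠ x ∧ 1 / r < G x y}))⁻¹ *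
                (∫⁻ w in insert x {y : X | y ≠ x ∧ 1 / r < G x y}, f w ∂μ) ≤
              ENNReal.ofReal C *
                ⨆ s ∈ Set.Ioi (0 : ℝ),
                  (μ (ball x s))⁻¹ * ∫⁻ w in ball x s, f w ∂μ) ∧
          (⨆ r ∈ Set.Ioi (0 : ℝ),
              (μ (insert x {y : X | y ≠ x ∧ 1 / r < G x y}))⁻¹ *
                ∫⁻ w in insert x {y : X | y ≠ x ∧ 1 / r < G x y}, f w ∂μ) ≤
            ENNReal.ofReal C *
              ⨆ s ∈ Set.Ioi (0 : ℝ),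
                (μ (ball x s))⁻¹ * ∫⁻ w in ball x s, f w ∂μ := by
  obtain ⟨L, hL, hLC⟩ := exists_one_lt_lt_mul_rpow hc (sub_pos.2 hk) (C₂ ^ 2)
  have hL0 : 0 < L := by linarith
  refine ⟨(2 * L) ^ N, by positivity, ?_⟩
  intro X _ _ _ μ G hpos hfin hdoub hlow _ _ hG f _ x
  suffices h : ∀ r : ℝ, 0 < r →
      (μ (insert x {y : X | y ≠ x ∧ 1 / r < G x y}))⁻¹ *
          (∫⁻ w in insert x {y : X | y ≠ x ∧ 1 / r < G x y}, f w ∂μ) ≤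
        ENNReal.ofReal ((2 * L) ^ N) *
          ⨆ s ∈ Set.Ioi (0 : ℝ), (μ (ball x s))⁻¹ * ∫⁻ w in ball x s, f w ∂μ from
    ⟨h, iSup₂_le h⟩
  intro r hr
  rcases superlevel_eq_singleton_or_between_balls hc hk (by linarith) (hlow x) (hG x) hL hLC
    (one_div_pos.2 hr) with hsing | ⟨s, hs, hsub, hsup⟩
  · have hzero : μ {x} = 0 :=
      measure_singleton_eq_zero_of_growth hc (by linarith) (hfin x 1 one_pos) (hlow x)
    rw [hsing, Measure.restrict_eq_zero.2 hzero]
    simp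
  · have hsL : 0 < s / L := by positivity
    have hlt : s / L < 2 * s := by
      rw [div_lt_iff₀ hL0]; nlinarith
    have hd := hdoub x (s / L) (2 * s) hsL hlt
    have hquot : 2 * s / (s / L) = 2 * L := by field_simp
    rw [hquot] at hd
    have hinv : (μ (ball x (s / L)))⁻¹ ≤
        ENNReal.ofReal ((2 * L) ^ N) * (μ (ball x (2 * s)))⁻¹ := by
      rw [← div_eq_mul_inv, ENNReal.le_div_iff_mul_le (Or.inl (hpos x _ (by positivity)).ne')
        (Or.inl (hfin x _ (by positivity)).ne), mul_comm, ← div_eq_mul_inv]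
      exact ENNReal.div_le_of_le_mul hd
    calc _ ≤ (μ (ball x (s / L)))⁻¹ * ∫⁻ w in ball x (2 * s), f w ∂μ :=
          mul_le_mul' (ENNReal.inv_le_inv.2 (measure_mono hsub)) (lintegral_mono_set hsup)
      _ ≤ ENNReal.ofReal ((2 * L) ^ N) *
            ((μ (ball x (2 * s)))⁻¹ * ∫⁻ w in ball x (2 * s), f w ∂μ) := by
          rw [← mul_assoc]; gcongr
      _ ≤ _ := by
          gcongr
          exact le_iSup₂ (f := fun s (_ : s ∈ Set.Ioi (0 : ℝ)) =>
            (μ (ball x s))⁻¹ * ∫⁻ w in ball x s, f w ∂μ) (2 * s)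
            (Set.mem_Ioi.2 (by positivity))
end

section
/- Let (X,d) be a metric space and μ a Borel measure on X with 0 < μ(B(x,r)) < ∞ for every x ∈ X and r > 0. Assume that μ is doubling with constant C_D and that F(x,r) < ∞ for every x ∈ X and r > 0. Let G be a Borel symmetric kernel comparable to F with constant C₂ ≥ 1, and define d_G(x,y) := 1/G(x,y) for x ≠ y and d_G(x,x) := 0. Then there exists a constant C_T ≥ 1, depending only on C_D and C₂, such that d_G(x,y) ≤ C_T · ( d_G(x,z) + d_G(z,y) ) for all x, y, z ∈ X. -/
open MeasureTheory Metric Set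
open scoped ENNReal

/-- Change of variables and doubling: halving the radius costs at most the doubling constant. -/
theorem lintegral_Ioi_half_le_of_doubling {X : Type*} [PseudoMetricSpace X] [MeasurableSpace X]
    (μ : Measure X) {C : ℝ} (hC : 1 ≤ C) (x : X)
    (hd : ∀ r : ℝ, 0 < r → μ (ball x (2 * r)) ≤ ENNReal.ofReal C * μ (ball x r))
    {r : ℝ} (hr : 0 < r) :
    (∫⁻ s in Ioi (r / 2), ENNReal.ofReal s / μ (ball x s)) ≤
      ENNReal.ofReal C * ∫⁻ s in Ioi r, ENNReal.ofReal s / μ (ball x s) := by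
  have himage : (fun t : ℝ => t / 2) '' Ioi r = Ioi (r / 2) := by
    ext t
    simp only [mem_image, mem_Ioi]
    constructor
    · rintro ⟨u, hu, rfl⟩
      linarith
    · exact fun ht => ⟨2 * t, by linarith, by ring⟩
  have hC0 : ENNReal.ofReal C ≠ 0 := by
    rw [Ne, ENNReal.ofReal_eq_zero]
    linarith
  rw [← himage, lintegral_image_eq_lintegral_abs_deriv_mul (f := fun t : ℝ => t / 2)
    (f' := fun _ => 1 / 2)
    measurableSet_Ioi (fun t _ => ((hasDerivAt_id t).div_const 2).hasDerivWithinAt)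
    (fun a _ b _ hab => by simpa using hab), ← lintegral_const_mul' _ _ ENNReal.ofReal_ne_top]
  refine setLIntegral_mono' measurableSet_Ioi fun t ht => ?_
  have ht0 : 0 < t := hr.trans ht
  have hdt : μ (ball x t) ≤ ENNReal.ofReal C * μ (ball x (t / 2)) := by
    simpa [mul_div_cancel₀] using hd (t / 2) (by linarith)
  have hinv : (μ (ball x (t / 2)))⁻¹ ≤ ENNReal.ofReal C * (μ (ball x t))⁻¹ := by
    have h := ENNReal.inv_le_inv.2 hdt
    rw [ENNReal.mul_inv (Or.inl hC0) (Or.inl ENNReal.ofReal_ne_top)] at h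
    calc (μ (ball x (t / 2)))⁻¹
        = ENNReal.ofReal C * ((ENNReal.ofReal C)⁻¹ * (μ (ball x (t / 2)))⁻¹) := by
          rw [← mul_assoc, ENNReal.mul_inv_cancel hC0 ENNReal.ofReal_ne_top, one_mul]
      _ ≤ _ := by gcongr
  calc ENNReal.ofReal |1 / 2| * (ENNReal.ofReal (t / 2) / μ (ball x (t / 2)))
      ≤ 1 * (ENNReal.ofReal t * (ENNReal.ofReal C * (μ (ball x t))⁻¹)) := by
        rw [div_eq_mul_inv (ENNReal.ofReal (t / 2))]
        gcongr
        · rw [ENNReal.ofReal_le_one, abs_of_pos] <;> norm_num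
        · linarith
    _ = ENNReal.ofReal C * (ENNReal.ofReal t / μ (ball x t)) := by
        rw [div_eq_mul_inv, one_mul, mul_left_comm]

/-- Almost triangle inequality: on a doubling (constant `C_D`) metric measure space with
`F` everywhere finite and a symmetric kernel `G` comparable to `F` with constant `C₂`,
the quasi-metric `d_G = 1/G` satisfies `d_G(x,y) ≤ C_T (d_G(x,z) + d_G(z,y))` with
`C_T ≥ 1` depending only on `C_D` and `C₂`. -/
theorem stmt_6 (C_D C₂ : ℝ) (hC_D : 1 ≤ C_D) (hC₂ : 1 ≤ C₂) :
    ∃ C_T : ℝ, 1 ≤ C_T ∧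
      ∀ (X : Type) [MetricSpace X] [MeasurableSpace X] [BorelSpace X]
        (μ : Measure X) (G : X → X → ℝ) (dG : X → X → ℝ),
        (∀ (x : X) (r : ℝ), 0 < r → 0 < μ (ball x r)) →
        (∀ (x : X) (r : ℝ), 0 < r → μ (ball x r) < ⊤) →
        (∀ (x : X) (r : ℝ), 0 < r →
          μ (ball x (2 * r)) ≤ ENNReal.ofReal C_D * μ (ball x r)) →
        (∀ (x : X) (r : ℝ), 0 < r →
          (∫⁻ s in Set.Ioi r, ENNReal.ofReal s / μ (ball x s)) < ⊤) →
        (∀ x y : X, x ≠ y → 0 < G x y) →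
        (∀ x y : X, x ≠ y → G x y = G y x) →
        (∀ x y : X, x ≠ y →
          ENNReal.ofReal C₂⁻¹ *
              (∫⁻ s in Set.Ioi (dist x y), ENNReal.ofReal s / μ (ball x s)) ≤
            ENNReal.ofReal (G x y) ∧
          ENNReal.ofReal (G x y) ≤
            ENNReal.ofReal C₂ *
              ∫⁻ s in Set.Ioi (dist x y), ENNReal.ofReal s / μ (ball x s)) →
        (∀ x : X, dG x x = 0) →
        (∀ x y : X, x ≠ y → dG x y = (G x y)⁻¹) →
        ∀ x y z : X, dG x y ≤ C_T * (dG x z + dG z y) := by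
  refine ⟨C₂ * C₂ * C_D, one_le_mul_of_one_le_of_one_le
    (one_le_mul_of_one_le_of_one_le hC₂ hC₂) hC_D, ?_⟩
  intro X _ _ _ μ G dG _ _ hdoub _ hG hsymm hcomp hdiag hoff x y z
  have hC₂0 : 0 < C₂ := by linarith
  have hnonneg : ∀ a b, 0 ≤ dG a b := by
    intro a b
    rcases eq_or_ne a b with rfl | hab
    · exact (hdiag a).ge
    · rw [hoff a b hab]
      exact (inv_pos.2 (hG a b hab)).le
  have hC : 0 ≤ C₂ * C₂ * C_D := by positivity
  have hdsymm : ∀ a b, dG a b = dG b a := by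
    intro a b
    rcases eq_or_ne a b with rfl | hab
    · rfl
    · rw [hoff a b hab, hoff b a hab.symm, hsymm a b hab]
  have key : ∀ a b c : X, a ≠ b → dist a b / 2 ≤ dist a c →
      dG a b ≤ C₂ * C₂ * C_D * dG a c := by
    intro a b c hab hle
    have hdab : 0 < dist a b := dist_pos.2 hab
    have hac : a ≠ c := dist_pos.1 (by linarith)
    have hFG : (∫⁻ s in Ioi (dist a b), ENNReal.ofReal s / μ (ball a s)) ≤
        ENNReal.ofReal C₂ * ENNReal.ofReal (G a b) := by
      have h := (hcomp a b hab).1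
      rwa [ENNReal.ofReal_inv_of_pos hC₂0, ← ENNReal.div_eq_inv_mul,
        ENNReal.div_le_iff' (by simpa using hC₂0) ENNReal.ofReal_ne_top] at h
    have hGG : ENNReal.ofReal (G a c) ≤ ENNReal.ofReal (C₂ * C₂ * C_D * G a b) := by
      calc ENNReal.ofReal (G a c)
          ≤ ENNReal.ofReal C₂ * ∫⁻ s in Ioi (dist a c), ENNReal.ofReal s / μ (ball a s) :=
            (hcomp a c hac).2
        _ ≤ ENNReal.ofReal C₂ * ∫⁻ s in Ioi (dist a b / 2), ENNReal.ofReal s / μ (ball a s) := by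
            gcongr
        _ ≤ ENNReal.ofReal C₂ * (ENNReal.ofReal C_D *
              (ENNReal.ofReal C₂ * ENNReal.ofReal (G a b))) := by
            gcongr
            exact (lintegral_Ioi_half_le_of_doubling μ hC_D a (hdoub a) hdab).trans (by gcongr)
        _ = ENNReal.ofReal (C₂ * C₂ * C_D * G a b) := by
            rw [ENNReal.ofReal_mul hC, ENNReal.ofReal_mul (by positivity),
              ENNReal.ofReal_mul hC₂0.le]
            ring
    have hreal : G a c ≤ C₂ * C₂ * C_D * G a b :=
      (ENNReal.ofReal_le_ofReal_iff (mul_nonneg hC (hG a b hab).le)).1 hGG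
    rw [hoff a b hab, hoff a c hac, ← div_eq_mul_inv, inv_le_iff_one_le_mul₀ (hG a b hab),
      div_mul_eq_mul_div, one_le_div (hG a c hac)]
    exact hreal
  rcases eq_or_ne x y with rfl | hxy
  · rw [hdiag]
    exact mul_nonneg hC (add_nonneg (hnonneg _ _) (hnonneg _ _))
  rw [mul_add]
  have hxz := mul_nonneg hC (hnonneg x z)
  have hzy := mul_nonneg hC (hnonneg z y)
  rcases le_total (dist x y / 2) (dist x z) with h | h
  · linarith [key x y z hxy h]
  · have h' : dist y x / 2 ≤ dist y z := by
      rw [dist_comm y x, dist_comm y z]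
      linarith [dist_triangle x z y]
    have hk := key y x z hxy.symm h'
    rw [hdsymm y x, hdsymm y z] at hk
    linarith
end

section
/- Let (X,d) be a metric space and μ a Borel measure on X with 0 < μ(B(x,r)) < ∞ for every x ∈ X and r > 0. Assume that μ is doubling with constant C_D and non-parabolic. Then there exists a constant C > 0, depending only on C_D, such that for all x, y, z ∈ X it holds F(x,d(x,z)) · F(y,d(y,z)) ≤ C · ( F(x,d(x,y)) · F(y,d(y,z)) + F(y,d(x,y)) · F(x,d(x,z)) ), where the inequality is understood in the extended real numbers [0,∞] (with F(w,0) := ∫_0^∞ s/μ(B(w,s)) ds, possibly infinite). -/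
open MeasureTheory Metric Set
open scoped ENNReal

/-- Under doubling, halving the lower limit of the integral of `s / μ (ball x s)` costs at most
a factor of the doubling constant. -/
lemma lintegral_Ioi_half_le_s7 {X : Type*} [PseudoMetricSpace X] [MeasurableSpace X]
    {μ : Measure X} {C : ℝ} (hC : 0 < C) (x : X)
    (hμ : ∀ r : ℝ, 0 < r → μ (ball x (2 * r)) ≤ ENNReal.ofReal C * μ (ball x r))
    {r : ℝ} (hr : 0 ≤ r) :
    (∫⁻ s in Set.Ioi (r / 2), ENNReal.ofReal s / μ (ball x s)) ≤
      ENNReal.ofReal C * ∫⁻ s in Set.Ioi r, ENNReal.ofReal s / μ (ball x s) := by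
  have himage : (fun t : ℝ => (1 / 2 : ℝ) * t) '' Set.Ioi r = Set.Ioi (r / 2) := by
    rw [Set.image_mul_left_Ioi (by norm_num)]
    congr 1
    ring
  rw [← himage, lintegral_image_eq_lintegral_abs_deriv_mul measurableSet_Ioi
    (f' := fun _ => (1 / 2 : ℝ))
    (fun t _ => by simpa using ((hasDerivAt_id t).const_mul (1 / 2 : ℝ)).hasDerivWithinAt)
    (fun a _ b _ h => by simpa using h),
    ← lintegral_const_mul' _ _ ENNReal.ofReal_ne_top]
  refine setLIntegral_mono' measurableSet_Ioi fun t ht => ?_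
  have ht0 : 0 < t := hr.trans_lt ht
  have hball : μ (ball x t) ≤ ENNReal.ofReal C * μ (ball x (1 / 2 * t)) := by
    have h := hμ (1 / 2 * t) (by positivity)
    rwa [show 2 * (1 / 2 * t) = t by ring] at h
  have hC0 : ENNReal.ofReal C ≠ 0 := by simpa using hC
  have hinv : (μ (ball x (1 / 2 * t)))⁻¹ ≤ ENNReal.ofReal C * (μ (ball x t))⁻¹ := by
    calc (μ (ball x (1 / 2 * t)))⁻¹
        = ENNReal.ofReal C * (ENNReal.ofReal C * μ (ball x (1 / 2 * t)))⁻¹ := by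
          rw [ENNReal.mul_inv (Or.inl hC0) (Or.inl ENNReal.ofReal_ne_top), ← mul_assoc,
            ENNReal.mul_inv_cancel hC0 ENNReal.ofReal_ne_top, one_mul]
      _ ≤ ENNReal.ofReal C * (μ (ball x t))⁻¹ := by gcongr
  have hhalf : ENNReal.ofReal |(1 / 2 : ℝ)| ≤ 1 :=
    ENNReal.ofReal_le_one.2 (by norm_num [abs_of_pos])
  calc ENNReal.ofReal |(1 / 2 : ℝ)| * (ENNReal.ofReal (1 / 2 * t) / μ (ball x (1 / 2 * t)))
      ≤ 1 * (ENNReal.ofReal t * (ENNReal.ofReal C * (μ (ball x t))⁻¹)) := by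
        rw [div_eq_mul_inv (ENNReal.ofReal _)]
        gcongr
        linarith
    _ = ENNReal.ofReal C * (ENNReal.ofReal t / μ (ball x t)) := by
        rw [one_mul, mul_left_comm, div_eq_mul_inv]

/-- On a doubling (constant `C_D`) non-parabolic metric measure space there is `C > 0`
depending only on `C_D` with
`F(x,d(x,z))·F(y,d(y,z)) ≤ C (F(x,d(x,y))·F(y,d(y,z)) + F(y,d(x,y))·F(x,d(x,z)))`
for all `x, y, z`, the inequality holding in `[0,∞]`. -/
theorem stmt_7 (C_D : ℝ) (hC_D : 1 ≤ C_D) :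
    ∃ C : ℝ, 0 < C ∧
      ∀ (X : Type) [MetricSpace X] [MeasurableSpace X] [BorelSpace X]
        (μ : Measure X),
        (∀ (x : X) (r : ℝ), 0 < r → 0 < μ (ball x r)) →
        (∀ (x : X) (r : ℝ), 0 < r → μ (ball x r) < ⊤) →
        (∀ (x : X) (r : ℝ), 0 < r →
          μ (ball x (2 * r)) ≤ ENNReal.ofReal C_D * μ (ball x r)) →
        (∃ x₀ : X,
          (∫⁻ s in Set.Ioi (1 : ℝ), ENNReal.ofReal s / μ (ball x₀ s)) < ⊤) →
        ∀ x y z : X,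
          (∫⁻ s in Set.Ioi (dist x z), ENNReal.ofReal s / μ (ball x s)) *
              (∫⁻ s in Set.Ioi (dist y z), ENNReal.ofReal s / μ (ball y s)) ≤
            ENNReal.ofReal C *
              ((∫⁻ s in Set.Ioi (dist x y), ENNReal.ofReal s / μ (ball x s)) *
                  (∫⁻ s in Set.Ioi (dist y z), ENNReal.ofReal s / μ (ball y s)) +
                (∫⁻ s in Set.Ioi (dist x y), ENNReal.ofReal s / μ (ball y s)) *
                  ∫⁻ s in Set.Ioi (dist x z), ENNReal.ofReal s / μ (ball x s)) := by
  have hC : 0 < C_D := by linarith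
  refine ⟨C_D, hC, fun X _ _ _ μ _ _ hμ _ x y z => ?_⟩
  rcases le_or_gt (dist x y / 2) (dist x z) with h | h
  · have hx := (lintegral_mono_set (Set.Ioi_subset_Ioi h)).trans
      (lintegral_Ioi_half_le_s7 hC x (hμ x) dist_nonneg)
    refine (mul_le_mul_left hx _).trans ?_
    rw [mul_assoc]
    gcongr
    exact le_self_add
  · have hyz : dist x y / 2 ≤ dist y z := by
      linarith [dist_triangle_right x y z]
    have hy := (lintegral_mono_set (Set.Ioi_subset_Ioi hyz)).trans
      (lintegral_Ioi_half_le_s7 hC y (hμ y) dist_nonneg)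
    rw [mul_comm]
    refine (mul_le_mul_left hy _).trans ?_
    rw [mul_assoc]
    gcongr
    exact le_add_self
end

section
/- Let (X,d) be a metric space and μ a Borel measure on X. Then for all x, y, z ∈ X it holds F(x,d(x,z)) · F(y,d(y,z)) ≤ F(x,d(x,y)/2) · F(y,d(y,z)) + F(y,d(x,y)/2) · F(x,d(x,z)), where the inequality is understood in [0,∞] (with F(w,0) := ∫_0^∞ s/μ(B(w,s)) ds and the convention 0·∞ = 0). -/
open MeasureTheory Metric Set
open scoped ENNReal

/-- For any metric space `(X,d)` with a Borel measure `μ` and any `x, y, z ∈ X`,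
`F(x,d(x,z))·F(y,d(y,z)) ≤ F(x,d(x,y)/2)·F(y,d(y,z)) + F(y,d(x,y)/2)·F(x,d(x,z))`
in `[0,∞]`, where `F(w,r) = ∫_r^∞ s/μ(B(w,s)) ds`. -/
theorem stmt_8 {X : Type*} [MetricSpace X] [MeasurableSpace X] [BorelSpace X]
    (μ : Measure X) (x y z : X) :
    (∫⁻ s in Set.Ioi (dist x z), ENNReal.ofReal s / μ (ball x s)) *
        (∫⁻ s in Set.Ioi (dist y z), ENNReal.ofReal s / μ (ball y s)) ≤
      (∫⁻ s in Set.Ioi (dist x y / 2), ENNReal.ofReal s / μ (ball x s)) *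
          (∫⁻ s in Set.Ioi (dist y z), ENNReal.ofReal s / μ (ball y s)) +
        (∫⁻ s in Set.Ioi (dist x y / 2), ENNReal.ofReal s / μ (ball y s)) *
          ∫⁻ s in Set.Ioi (dist x z), ENNReal.ofReal s / μ (ball x s) := by
  have hxy : dist x y ≤ dist x z + dist y z := dist_triangle_right x y z
  rcases le_total (dist x y / 2) (dist x z) with h | h
  · refine le_add_right ?_
    gcongr
  · have h' : dist x y / 2 ≤ dist y z := by linarith
    refine le_add_left ?_
    rw [mul_comm]
    gcongr
end

section
/- Let (X̄,d̄) be a metric space and μ a Borel measure on X̄ with 0 < μ(B̄(x,r)) < ∞ for every x and r > 0, which is doubling with constant C_μ ≥ 1. Fix a natural number k ≥ 1 and let Z := X̄ × ℝᵏ be endowed with the metric d_Z((x,v),(x',v')) := ( d̄(x,x')² + |v−v'|² )^{1/2} and the product measure m := μ ⊗ Lᵏ, where Lᵏ is the k-dimensional Lebesgue measure. Then for every z ∈ Z and all 0 < r < R it holds m(B_Z(z,R)) / m(B_Z(z,r)) ≥ (1/(C_μ · 2^{k/2})) · (R/r)^k. -/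
open MeasureTheory Metric Set
open scoped ENNReal

/-- Reverse Bishop–Gromov inequality: if `(X̄,d̄,μ)` is doubling with constant `C_μ` and
`Z = X̄ × ℝᵏ` carries the metric `d_Z = (d̄² + |·|²)^{1/2}` and the measure `m = μ ⊗ Lᵏ`,
then `m(B_Z(z,R))/m(B_Z(z,r)) ≥ (C_μ 2^{k/2})⁻¹ (R/r)^k` for all `z` and `0 < r < R`. -/
theorem stmt_9 {Xb : Type*} [MetricSpace Xb] [MeasurableSpace Xb] [BorelSpace Xb]
    (μ : Measure Xb) (C_μ : ℝ) (hC : 1 ≤ C_μ)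
    (hpos : ∀ (x : Xb) (r : ℝ), 0 < r → 0 < μ (ball x r))
    (hfin : ∀ (x : Xb) (r : ℝ), 0 < r → μ (ball x r) < ⊤)
    (hdoub : ∀ (x : Xb) (r : ℝ), 0 < r →
      μ (ball x (2 * r)) ≤ ENNReal.ofReal C_μ * μ (ball x r))
    (k : ℕ) (hk : 1 ≤ k)
    (m : Measure (Xb × EuclideanSpace ℝ (Fin k)))
    (hm : m = μ.prod volume)
    (BZ : Xb × EuclideanSpace ℝ (Fin k) → ℝ → Set (Xb × EuclideanSpace ℝ (Fin k)))
    (hBZ : ∀ z r, BZ z r =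
      {w | Real.sqrt (dist z.1 w.1 ^ 2 + dist z.2 w.2 ^ 2) < r}) :
    ∀ (z : Xb × EuclideanSpace ℝ (Fin k)) (r R : ℝ), 0 < r → r < R →
      ENNReal.ofReal ((C_μ * 2 ^ ((k : ℝ) / 2))⁻¹ * (R / r) ^ k) ≤
        m (BZ z R) / m (BZ z r) := by
  rintro ⟨x, v⟩ r R hr hrR
  subst hm
  have hR : 0 < R := hr.trans hrR
  have hC0 : 0 < C_μ := zero_lt_one.trans_le hC
  have hs : 0 < √(2 : ℝ) := by positivity
  have hs2 : √(2 : ℝ) ^ 2 = 2 := Real.sq_sqrt zero_le_two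
  have hRs : 0 < R / √2 := by positivity
  have hlower : ball x (R / √2) ×ˢ ball v (R / √2) ⊆ BZ (x, v) R := by
    rintro ⟨y, w⟩ ⟨hy, hw⟩
    rw [mem_ball'] at hy hw
    rw [hBZ, mem_ofPred_eq, Real.sqrt_lt' hR]
    have h1 : dist x y ^ 2 < (R / √2) ^ 2 := by gcongr
    have h2 : dist v w ^ 2 < (R / √2) ^ 2 := by gcongr
    rw [div_pow, hs2] at h1 h2
    linarith
  have hupper : BZ (x, v) r ⊆ ball x r ×ˢ ball v r := by
    rintro ⟨y, w⟩ h
    rw [hBZ, mem_ofPred_eq, Real.sqrt_lt' hr] at h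
    refine ⟨mem_ball'.2 (lt_of_pow_lt_pow_left₀ 2 hr.le ?_),
      mem_ball'.2 (lt_of_pow_lt_pow_left₀ 2 hr.le ?_)⟩
    · linarith [sq_nonneg (dist v w)]
    · linarith [sq_nonneg (dist x y)]
  have hdouble : μ (ball x r) ≤ ENNReal.ofReal C_μ * μ (ball x (R / √2)) := by
    refine le_trans (measure_mono (ball_subset_ball ?_)) (hdoub x _ hRs)
    have hle : √(2 : ℝ) ≤ 2 := Real.sqrt_le_iff.2 (by norm_num)
    have : R ≤ 2 * (R / √2) := by
      rw [← mul_div_assoc, le_div_iff₀ hs]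
      nlinarith
    linarith
  have hvol (s : ℝ) (hs : 0 < s) : volume (ball v s) =
      ENNReal.ofReal (s ^ k) * volume (ball (0 : EuclideanSpace ℝ (Fin k)) 1) := by
    simpa using Measure.addHaar_ball_of_pos volume v hs
  have hconst : ENNReal.ofReal ((C_μ * 2 ^ ((k : ℝ) / 2))⁻¹ * (R / r) ^ k) *
      (ENNReal.ofReal C_μ * ENNReal.ofReal (r ^ k)) = ENNReal.ofReal ((R / √2) ^ k) := by
    have hpow : (2 : ℝ) ^ ((k : ℝ) / 2) = √2 ^ k := by
      rw [Real.sqrt_eq_rpow, ← Real.rpow_natCast, ← Real.rpow_mul zero_le_two]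
      congr 1
      ring
    rw [← ENNReal.ofReal_mul hC0.le, ← ENNReal.ofReal_mul (by positivity), hpow]
    congr 1
    rw [div_pow, div_pow]
    field_simp
  refine le_trans ?_ (ENNReal.div_le_div (measure_mono hlower) (measure_mono hupper))
  rw [Measure.prod_prod, Measure.prod_prod]
  have hball : volume (ball v r) ≠ 0 := (measure_ball_pos volume v hr).ne'
  rw [ENNReal.le_div_iff_mul_le (.inl (mul_ne_zero (hpos x r hr).ne' hball))
    (.inl (ENNReal.mul_ne_top (hfin x r hr).ne measure_ball_lt_top.ne)),
    hvol r hr, hvol _ hRs, ← hconst]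
  calc _ ≤ _ * (ENNReal.ofReal C_μ * μ (ball x (R / √2)) * _) := by gcongr
    _ = _ := by ring
end

section
/- Let (X,d) be a metric space and μ a Borel measure on X with 0 < μ(B(x,r)) < ∞ for every x ∈ X and r > 0. Assume there exist c ∈ (0,1] and k > 2 such that μ(B(x,R)) ≥ c·(R/r)^k·μ(B(x,r)) for all x ∈ X and 0 < r < R. Then F(x,r) < ∞ for every x ∈ X and r > 0, and there exist constants C ≥ 1 and γ ∈ (0,1), depending only on c and k, such that for every x ∈ X and R > 0 it holds F(x,R) ≤ C · R² / μ(B(x,R)) and F(x,2R) ≤ γ · F(x,R). -/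
open MeasureTheory Metric Set
open scoped ENNReal

/-- Integrating `s / m s` over `(R, ∞)` when `m` grows at least like `c (s / R) ^ k`. -/
theorem lintegral_Ioi_div_le_of_growth_s10 {c k R : ℝ} (hc : 0 < c) (hk : 2 < k) (hR : 0 < R)
    {m : ℝ → ℝ≥0∞}
    (hm : ∀ s, R < s → ENNReal.ofReal (c * (s / R) ^ k) * m R ≤ m s) :
    (∫⁻ s in Ioi R, ENNReal.ofReal s / m s) ≤
      ENNReal.ofReal (c⁻¹ / (k - 2)) * (ENNReal.ofReal (R ^ 2) / m R) := by
  have hpt : ∀ s ∈ Ioi R, ENNReal.ofReal s / m s ≤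
      ENNReal.ofReal (c⁻¹ * R ^ k) * (m R)⁻¹ * ENNReal.ofReal (s ^ (1 - k)) := by
    intro s hs
    have hs0 : 0 < s := hR.trans hs
    have ha : 0 < c * (s / R) ^ k := by positivity
    have ha0 : ENNReal.ofReal (c * (s / R) ^ k) ≠ 0 := by simpa using ha
    refine (ENNReal.div_le_div_left (hm s hs) _).trans_eq ?_
    rw [div_eq_mul_inv, ENNReal.mul_inv (Or.inl ha0) (Or.inl ENNReal.ofReal_ne_top),
      ← ENNReal.ofReal_inv_of_pos ha, mul_right_comm, ← mul_assoc,
      ← ENNReal.ofReal_mul hs0.le, ← ENNReal.ofReal_mul (by positivity)]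
    congr 2
    rw [Real.div_rpow hs0.le hR.le, Real.rpow_sub hs0, Real.rpow_one]
    field_simp
  refine (setLIntegral_mono' measurableSet_Ioi hpt).trans_eq ?_
  rw [lintegral_const_mul _ (by fun_prop),
    ← ofReal_integral_eq_lintegral_ofReal (integrableOn_Ioi_rpow_of_lt (by linarith) hR)
      ((ae_restrict_mem measurableSet_Ioi).mono
        fun s hs => Real.rpow_nonneg (hR.trans hs).le _),
    integral_Ioi_rpow_of_lt (by linarith) hR, mul_right_comm,
    ← ENNReal.ofReal_mul (by positivity), div_eq_mul_inv (ENNReal.ofReal (R ^ 2)), ← mul_assoc,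
    ← ENNReal.ofReal_mul (div_nonneg (by positivity) (by linarith))]
  congr 2
  have hpow : R ^ k * R ^ (1 - k + 1) = R ^ 2 := by
    rw [← Real.rpow_add hR, ← Real.rpow_natCast]
    congr 1
    push_cast
    ring
  rw [← hpow, show 1 - k + 1 = -(k - 2) by ring, neg_div_neg_eq]
  ring

/-- The mass of `s / m s` on `(R, 2R]` is at least `R² / m (2R)` for monotone `m`. -/
theorem div_le_lintegral_Ioc_two_mul {R : ℝ} (hR : 0 < R) {m : ℝ → ℝ≥0∞} (hm : Monotone m) :
    ENNReal.ofReal (R ^ 2) / m (2 * R) ≤ ∫⁻ s in Ioc R (2 * R), ENNReal.ofReal s / m s := by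
  calc ENNReal.ofReal (R ^ 2) / m (2 * R)
      = ∫⁻ _ in Ioc R (2 * R), ENNReal.ofReal R / m (2 * R) := by
        rw [setLIntegral_const, Real.volume_Ioc, show 2 * R - R = R by ring,
          div_eq_mul_inv, div_eq_mul_inv, mul_right_comm, ← ENNReal.ofReal_mul hR.le, sq]
    _ ≤ _ := setLIntegral_mono' measurableSet_Ioc fun s hs =>
        ENNReal.div_le_div (ENNReal.ofReal_le_ofReal hs.1.le) (hm hs.2)

theorem ENNReal.le_ofReal_div_one_add_mul_add {D : ℝ} (hD : 0 ≤ D) {a b : ℝ≥0∞}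
    (h : a ≤ ENNReal.ofReal D * b) : a ≤ ENNReal.ofReal (D / (1 + D)) * (b + a) := by
  have hD1 : 0 < 1 + D := by linarith
  rw [ENNReal.ofReal_div_of_pos hD1, ENNReal.mul_comm_div, ← mul_div_assoc,
    ENNReal.le_div_iff_mul_le (Or.inl (by simpa using hD1)) (Or.inl ENNReal.ofReal_ne_top),
    ENNReal.ofReal_add zero_le_one hD, ENNReal.ofReal_one, mul_add, mul_add, mul_one,
    mul_comm a]
  gcongr

/-- Under a reverse doubling condition with exponent `k > 2` and constant `c`, the function
`F(x,r) = ∫_r^∞ s/μ(B(x,s)) ds` is finite, and there are `C ≥ 1` and `γ ∈ (0,1)` depending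
only on `c` and `k` with `F(x,R) ≤ C R²/μ(B(x,R))` and `F(x,2R) ≤ γ F(x,R)`. -/
theorem stmt_10 (c k : ℝ) (hc : 0 < c) (hc1 : c ≤ 1) (hk : 2 < k) :
    ∃ C γ : ℝ, 1 ≤ C ∧ 0 < γ ∧ γ < 1 ∧
      ∀ (X : Type) [MetricSpace X] [MeasurableSpace X] [BorelSpace X]
        (μ : Measure X),
        (∀ (x : X) (r : ℝ), 0 < r → 0 < μ (ball x r)) →
        (∀ (x : X) (r : ℝ), 0 < r → μ (ball x r) < ⊤) →
        (∀ (x : X) (r R : ℝ), 0 < r → r < R →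
          ENNReal.ofReal (c * (R / r) ^ k) * μ (ball x r) ≤ μ (ball x R)) →
        (∀ (x : X) (r : ℝ), 0 < r →
          (∫⁻ s in Set.Ioi r, ENNReal.ofReal s / μ (ball x s)) < ⊤) ∧
        ∀ (x : X) (R : ℝ), 0 < R →
          (∫⁻ s in Set.Ioi R, ENNReal.ofReal s / μ (ball x s)) ≤
            ENNReal.ofReal C * (ENNReal.ofReal (R ^ 2) / μ (ball x R)) ∧
          (∫⁻ s in Set.Ioi (2 * R), ENNReal.ofReal s / μ (ball x s)) ≤
            ENNReal.ofReal γ *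
              ∫⁻ s in Set.Ioi R, ENNReal.ofReal s / μ (ball x s) := by
  set C : ℝ := max 1 (c⁻¹ / (k - 2))
  have hC : 1 ≤ C := le_max_left _ _
  refine ⟨C, 4 * C / (1 + 4 * C), hC, by positivity,
    (div_lt_one (by positivity)).2 (by linarith), ?_⟩
  intro X _ _ _ μ hpos hfin hgrow
  have hbound : ∀ (x : X) (R : ℝ), 0 < R →
      (∫⁻ s in Ioi R, ENNReal.ofReal s / μ (ball x s)) ≤
        ENNReal.ofReal C * (ENNReal.ofReal (R ^ 2) / μ (ball x R)) := fun x R hR =>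
    (lintegral_Ioi_div_le_of_growth_s10 (m := fun s => μ (ball x s)) hc hk hR
      fun s hs => hgrow x R s hR hs).trans (by gcongr; exact le_max_right _ _)
  have hlt : ∀ (x : X) (r : ℝ), 0 < r →
      (∫⁻ s in Ioi r, ENNReal.ofReal s / μ (ball x s)) < ⊤ := fun x r hr =>
    (hbound x r hr).trans_lt (ENNReal.mul_lt_top ENNReal.ofReal_lt_top
      (ENNReal.div_lt_top ENNReal.ofReal_ne_top (hpos x r hr).ne'))
  refine ⟨hlt, fun x R hR => ⟨hbound x R hR, ?_⟩⟩
  have h2R : 0 < 2 * R := by positivity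
  rw [← Ioc_union_Ioi_eq_Ioi (show R ≤ 2 * R by linarith),
    lintegral_union measurableSet_Ioi (Ioc_disjoint_Ioi le_rfl)]
  refine ENNReal.le_ofReal_div_one_add_mul_add (by positivity) ?_
  calc (∫⁻ s in Ioi (2 * R), ENNReal.ofReal s / μ (ball x s))
      ≤ ENNReal.ofReal C * (ENNReal.ofReal ((2 * R) ^ 2) / μ (ball x (2 * R))) :=
        hbound x _ h2R
    _ = ENNReal.ofReal (4 * C) * (ENNReal.ofReal (R ^ 2) / μ (ball x (2 * R))) := by
        rw [← mul_div_assoc, ← mul_div_assoc, ← ENNReal.ofReal_mul (by positivity),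
          ← ENNReal.ofReal_mul (by positivity)]
        congr 2
        ring
    _ ≤ _ := by
        gcongr
        exact div_le_lintegral_Ioc_two_mul (m := fun s => μ (ball x s)) hR
          fun s t hst => measure_mono (ball_subset_ball hst)
end

section
/- Let (X,d) be a complete separable metric space and μ a Borel measure on X with 0 < μ(B(x,r)) < ∞ for every x ∈ X and r > 0, and assume μ is non-parabolic. Then for every x ∈ X the functions y ↦ F(x,d(x,y)) and y ↦ H(x,d(x,y)) are integrable with respect to μ on every ball of X; moreover the function (w,z) ↦ H(w,d(w,z)) is integrable with respect to the product measure μ⊗μ on B × B for every ball B ⊆ X. -/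
open MeasureTheory Metric Set
open scoped ENNReal

/-- Tonelli: integrating the tail integrals from `dist x y` in `y` weighs the integrand by the
measure of balls. -/
theorem lintegral_lintegral_Ioi_dist {X : Type*} [MetricSpace X]
    [SecondCountableTopology X] [MeasurableSpace X] [BorelSpace X]
    (ν : Measure X) [SFinite ν] (x : X) {g : ℝ → ℝ≥0∞} (hg : Measurable g) :
    ∫⁻ y, (∫⁻ s in Ioi (dist x y), g s) ∂ν = ∫⁻ s in Ioi (0 : ℝ), g s * ν (ball x s) := by
  have hmeas : MeasurableSet {p : X × ℝ | dist x p.1 < p.2} :=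
    measurableSet_lt (by fun_prop) measurable_snd
  have h1 : ∀ y, ∫⁻ s in Ioi (dist x y), g s
      = ∫⁻ s, {p : X × ℝ | dist x p.1 < p.2}.indicator (fun p => g p.2) (y, s) := by
    intro y
    rw [← lintegral_indicator measurableSet_Ioi]
    rfl
  simp_rw [h1]
  rw [lintegral_lintegral_swap
    (f := fun y s => {p : X × ℝ | dist x p.1 < p.2}.indicator (fun p => g p.2) (y, s))
    ((hg.comp measurable_snd).indicator hmeas).aemeasurable,
    ← lintegral_indicator measurableSet_Ioi]
  refine lintegral_congr fun s => ?_
  have h2 : ∀ y, {p : X × ℝ | dist x p.1 < p.2}.indicator (fun p => g p.2) (y, s)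
      = (ball x s).indicator (fun _ => g s) y := by
    intro y
    simp only [indicator, mem_ofPred_eq, mem_ball, dist_comm]
  simp_rw [h2]
  rw [lintegral_indicator_const measurableSet_ball]
  by_cases hs : 0 < s
  · simp [hs]
  · simp [hs, ball_eq_empty.2 (not_lt.1 hs)]

theorem measurable_measure_ball {X : Type*} [MetricSpace X] [MeasurableSpace X]
    (μ : Measure X) (x : X) : Measurable fun s => μ (ball x s) :=
  Monotone.measurable fun _ _ h => measure_mono (ball_subset_ball h)

/-- Tail integrals of `s / μ (ball w s)` are controlled uniformly for `w` near the base point. -/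
theorem lintegral_Ioi_div_measure_ball_le {X : Type*} [MetricSpace X] [MeasurableSpace X]
    (μ : Measure X) {x₀ w : X} {T : ℝ} (hw : dist w x₀ + 1 ≤ T) :
    ∫⁻ s in Ioi T, ENNReal.ofReal s / μ (ball w s)
      ≤ ENNReal.ofReal T * ∫⁻ s in Ioi (1 : ℝ), ENNReal.ofReal s / μ (ball x₀ s) := by
  have hT : 1 ≤ T := by linarith [dist_nonneg (x := w) (y := x₀)]
  rw [← lintegral_const_mul' _ _ ENNReal.ofReal_ne_top,
    ← lintegral_indicator measurableSet_Ioi, ← lintegral_indicator measurableSet_Ioi,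
    ← lintegral_sub_right_eq_self ((Ioi (1 : ℝ)).indicator _) (T - 1)]
  refine lintegral_mono fun s => ?_
  by_cases hs : T < s
  · have hs' : 1 < s - (T - 1) := by linarith
    rw [indicator_of_mem (mem_Ioi.2 hs), indicator_of_mem (mem_Ioi.2 hs'), ← mul_div_assoc,
      ← ENNReal.ofReal_mul (by linarith)]
    refine ENNReal.div_le_div (ENNReal.ofReal_le_ofReal (by nlinarith)) (measure_mono ?_)
    exact ball_subset_ball' (by rw [dist_comm]; linarith)
  · rw [indicator_of_notMem (by simpa using hs)]
    exact zero_le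

theorem lintegral_lintegral_Ioi_dist_div_le {X : Type*} [MetricSpace X]
    [SecondCountableTopology X] [MeasurableSpace X] [BorelSpace X]
    (μ : Measure X) {B : Set X} (hB : μ B < ⊤) {x₀ w : X} {T : ℝ} (hw : dist w x₀ + 1 ≤ T)
    {c : ℝ → ℝ≥0∞} (hc : Measurable c) {M : ℝ≥0∞} (hM : ∀ s ≤ T, c s ≤ M)
    (hcT : ∀ s, T < s → c s ≤ ENNReal.ofReal s) :
    ∫⁻ y in B, (∫⁻ s in Ioi (dist w y), c s / μ (ball w s)) ∂μ
      ≤ M * ENNReal.ofReal T + ENNReal.ofReal T *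
        (∫⁻ s in Ioi (1 : ℝ), ENNReal.ofReal s / μ (ball x₀ s)) * μ B := by
  have hT : 0 ≤ T := by linarith [dist_nonneg (x := w) (y := x₀)]
  have : IsFiniteMeasure (μ.restrict B) := ⟨by simpa using hB⟩
  rw [lintegral_lintegral_Ioi_dist _ _ (g := fun s => c s / μ (ball w s))
      (hc.div (measurable_measure_ball μ w)),
    ← Ioc_union_Ioi_eq_Ioi hT]
  refine (lintegral_union_le _ _ _).trans (add_le_add ?_ ?_)
  · calc _ ≤ ∫⁻ _ in Ioc 0 T, M := by
          refine setLIntegral_mono' measurableSet_Ioc fun s hs => ?_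
          calc c s / μ (ball w s) * μ.restrict B (ball w s)
              ≤ c s / μ (ball w s) * μ (ball w s) := by
                gcongr; exact Measure.restrict_le_self
            _ ≤ c s := by
                rw [div_eq_mul_inv, mul_assoc]
                exact mul_le_of_le_one_right' (ENNReal.inv_mul_le_one _)
            _ ≤ M := hM s hs.2
      _ = _ := by simp
  · calc _ ≤ ∫⁻ s in Ioi T, ENNReal.ofReal s / μ (ball w s) * μ B := by
          refine setLIntegral_mono' measurableSet_Ioi fun s hs => ?_
          refine mul_le_mul' (ENNReal.div_le_div_right (hcT s hs) _) ?_
          exact (measure_mono (subset_univ _)).trans_eq (Measure.restrict_apply_univ B)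
      _ = (∫⁻ s in Ioi T, ENNReal.ofReal s / μ (ball w s)) * μ B :=
          lintegral_mul_const' _ _ hB.ne
      _ ≤ _ := by gcongr; exact lintegral_Ioi_div_measure_ball_le μ hw

/-- On a complete separable non-parabolic metric measure space, for every `x` the functions
`y ↦ F(x,d(x,y))` and `y ↦ H(x,d(x,y))` are `μ`-integrable on every ball, and
`(w,z) ↦ H(w,d(w,z))` is `μ⊗μ`-integrable on `B × B` for every ball `B`. -/
theorem stmt_11 {X : Type*} [MetricSpace X] [CompleteSpace X]
    [TopologicalSpace.SeparableSpace X] [MeasurableSpace X] [BorelSpace X]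
    (μ : Measure X)
    (hpos : ∀ (x : X) (r : ℝ), 0 < r → 0 < μ (ball x r))
    (hfin : ∀ (x : X) (r : ℝ), 0 < r → μ (ball x r) < ⊤)
    (hnp : ∃ x₀ : X,
      (∫⁻ s in Set.Ioi (1 : ℝ), ENNReal.ofReal s / μ (ball x₀ s)) < ⊤) :
    ∀ (x z : X) (R : ℝ), 0 < R →
      (∫⁻ y in ball z R,
          (∫⁻ s in Set.Ioi (dist x y), ENNReal.ofReal s / μ (ball x s)) ∂μ) < ⊤ ∧
      (∫⁻ y in ball z R,
          (∫⁻ s in Set.Ioi (dist x y), 1 / μ (ball x s)) ∂μ) < ⊤ ∧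
      (∫⁻ p in (ball z R) ×ˢ (ball z R),
          (∫⁻ s in Set.Ioi (dist p.1 p.2), 1 / μ (ball p.1 s)) ∂(μ.prod μ)) < ⊤ := by
  obtain ⟨x₀, hI⟩ := hnp
  intro x z R hR
  have := UniformSpace.secondCountable_of_separable X
  have : IsLocallyFiniteMeasure μ :=
    ⟨fun y => ⟨ball y 1, ball_mem_nhds y one_pos, hfin y 1 one_pos⟩⟩
  have hB := hfin z R hR
  have hbound : ∀ {M : ℝ≥0∞} (T : ℝ), M < ⊤ → M * ENNReal.ofReal T + ENNReal.ofReal T *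
      (∫⁻ s in Ioi (1 : ℝ), ENNReal.ofReal s / μ (ball x₀ s)) * μ (ball z R) < ⊤ :=
    fun T hM => ENNReal.add_lt_top.2 ⟨ENNReal.mul_lt_top hM ENNReal.ofReal_lt_top,
      ENNReal.mul_lt_top (ENNReal.mul_lt_top ENNReal.ofReal_lt_top hI) hB⟩
  have hH : ∀ {w : X} {T : ℝ}, dist w x₀ + 1 ≤ T →
      ∫⁻ y in ball z R, (∫⁻ s in Ioi (dist w y), 1 / μ (ball w s)) ∂μ
        ≤ 1 * ENNReal.ofReal T + ENNReal.ofReal T *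
          (∫⁻ s in Ioi (1 : ℝ), ENNReal.ofReal s / μ (ball x₀ s)) * μ (ball z R) := by
    intro w T hw
    refine lintegral_lintegral_Ioi_dist_div_le μ hB hw measurable_const (fun _ _ => le_rfl) ?_
    intro s hs
    exact ENNReal.one_le_ofReal.2 (by linarith [dist_nonneg (x := w) (y := x₀)])
  refine ⟨?_, ?_, ?_⟩
  · exact (lintegral_lintegral_Ioi_dist_div_le μ hB le_rfl ENNReal.measurable_ofReal
      (fun _ hs => ENNReal.ofReal_le_ofReal hs) (fun _ _ => le_rfl)).trans_lt
      (hbound _ ENNReal.ofReal_lt_top)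
  · exact (hH le_rfl).trans_lt (hbound _ ENNReal.one_lt_top)
  · rw [← Measure.prod_restrict]
    refine (lintegral_prod_le _).trans_lt ?_
    refine (setLIntegral_mono' (g := fun _ => _) measurableSet_ball fun w hw =>
      hH (T := R + dist z x₀ + 1) ?_).trans_lt ?_
    · linarith [dist_triangle w z x₀, mem_ball.1 hw]
    · rw [setLIntegral_const]
      exact ENNReal.mul_lt_top (hbound _ ENNReal.one_lt_top) hB
end

section
/- Let (X,d) be a metric space, μ a Borel measure on X, and x ∈ X a point with 0 < μ(B(x,s)) < ∞ for every s > 0. Then for every R > 0 the following identities hold in [0,∞]: ∫_{B(x,R)} F(x,d(x,w)) dμ(w) = R²/2 + F(x,R)·μ(B(x,R)) and ∫_{B(x,R)} H(x,d(x,w)) dμ(w) = R + H(x,R)·μ(B(x,R)). -/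
open MeasureTheory Metric Set
open scoped ENNReal

/-- Tonelli: integrating the tails of `c s / μ (ball x s)` over a ball. -/
theorem setLIntegral_ball_lintegral_Ioi_dist {X : Type*} [MetricSpace X] [MeasurableSpace X]
    [BorelSpace X] (μ : Measure X) (x : X)
    (hpos : ∀ s : ℝ, 0 < s → 0 < μ (ball x s)) (hfin : ∀ s : ℝ, 0 < s → μ (ball x s) < ⊤)
    {c : ℝ → ℝ≥0∞} (hc : Measurable c) {R : ℝ} (hR : 0 < R) :
    (∫⁻ w in ball x R, (∫⁻ s in Ioi (dist x w), c s / μ (ball x s)) ∂μ) =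
      (∫⁻ s in Ioc 0 R, c s) + (∫⁻ s in Ioi R, c s / μ (ball x s)) * μ (ball x R) := by
  have hm : Measurable fun s : ℝ => μ (ball x s) :=
    Monotone.measurable fun s t hst => measure_mono (ball_subset_ball hst)
  have hg : Measurable fun s : ℝ => c s / μ (ball x s) := hc.div hm
  have : IsFiniteMeasure (μ.restrict (ball x R)) :=
    ⟨by simpa using hfin R hR⟩
  have hset : MeasurableSet {p : X × ℝ | dist x p.1 < p.2} :=
    measurableSet_lt ((continuous_const.dist continuous_id).measurable.comp measurable_fst)
      measurable_snd
  have hswap : (∫⁻ w in ball x R, (∫⁻ s in Ioi (dist x w), c s / μ (ball x s)) ∂μ) =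
      ∫⁻ s, c s / μ (ball x s) * μ (ball x s ∩ ball x R) := by
    calc
      _ = ∫⁻ w in ball x R, (∫⁻ s, {p : X × ℝ | dist x p.1 < p.2}.indicator
            (fun p => c p.2 / μ (ball x p.2)) (w, s)) ∂μ := by
        refine lintegral_congr fun w => ?_
        rw [← lintegral_indicator measurableSet_Ioi]
        rfl
      _ = ∫⁻ s, (∫⁻ w in ball x R, {p : X × ℝ | dist x p.1 < p.2}.indicator
            (fun p => c p.2 / μ (ball x p.2)) (w, s) ∂μ) :=
        lintegral_lintegral_swap ((hg.comp measurable_snd).indicator hset).aemeasurable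
      _ = _ := by
        refine lintegral_congr fun s => ?_
        rw [← Measure.restrict_apply measurableSet_ball,
          ← lintegral_indicator_const measurableSet_ball]
        refine lintegral_congr fun w => ?_
        simp only [indicator, mem_ofPred_eq, mem_ball, dist_comm x w]
  have hsupp : (∫⁻ s, c s / μ (ball x s) * μ (ball x s ∩ ball x R)) =
      ∫⁻ s in Ioi 0, c s / μ (ball x s) * μ (ball x s ∩ ball x R) := by
    rw [← lintegral_indicator measurableSet_Ioi]
    refine lintegral_congr fun s => ?_
    by_cases hs : 0 < s
    · rw [indicator_of_mem (mem_Ioi.2 hs)]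
    · rw [indicator_of_notMem (by simpa using hs), ball_eq_empty.2 (not_lt.1 hs)]
      simp
  rw [hswap, hsupp, ← Ioc_union_Ioi_eq_Ioi hR.le,
    lintegral_union measurableSet_Ioi (Ioc_disjoint_Ioi le_rfl)]
  congr 1
  · refine setLIntegral_congr_fun measurableSet_Ioc fun s hs => ?_
    simp only [inter_eq_left.2 (ball_subset_ball hs.2)]
    exact ENNReal.div_mul_cancel (hpos s hs.1).ne' (hfin s hs.1).ne
  · rw [← lintegral_mul_const _ hg]
    refine setLIntegral_congr_fun measurableSet_Ioi fun s hs => ?_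
    simp only [inter_eq_right.2 (ball_subset_ball (le_of_lt hs))]

theorem setLIntegral_Ioc_zero_ofReal {R : ℝ} (hR : 0 ≤ R) :
    (∫⁻ s in Ioc 0 R, ENNReal.ofReal s) = ENNReal.ofReal (R ^ 2 / 2) := by
  rw [← ofReal_integral_eq_lintegral_ofReal, ← intervalIntegral.integral_of_le hR, integral_id]
  · simp
  · exact (intervalIntegrable_iff_integrableOn_Ioc_of_le hR).1
      (continuous_id.intervalIntegrable 0 R)
  · exact (ae_restrict_mem measurableSet_Ioc).mono fun s hs => hs.1.le

/-- For a point `x` with `0 < μ(B(x,s)) < ∞` for all `s > 0` and every `R > 0`: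
`∫_{B(x,R)} F(x,d(x,w)) dμ(w) = R²/2 + F(x,R)·μ(B(x,R))` and
`∫_{B(x,R)} H(x,d(x,w)) dμ(w) = R + H(x,R)·μ(B(x,R))`. -/
theorem stmt_12 {X : Type*} [MetricSpace X] [MeasurableSpace X] [BorelSpace X]
    (μ : Measure X) (x : X)
    (hpos : ∀ s : ℝ, 0 < s → 0 < μ (ball x s))
    (hfin : ∀ s : ℝ, 0 < s → μ (ball x s) < ⊤) :
    ∀ R : ℝ, 0 < R →
      (∫⁻ w in ball x R,
          (∫⁻ s in Set.Ioi (dist x w), ENNReal.ofReal s / μ (ball x s)) ∂μ) =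
        ENNReal.ofReal (R ^ 2 / 2) +
          (∫⁻ s in Set.Ioi R, ENNReal.ofReal s / μ (ball x s)) * μ (ball x R) ∧
      (∫⁻ w in ball x R,
          (∫⁻ s in Set.Ioi (dist x w), 1 / μ (ball x s)) ∂μ) =
        ENNReal.ofReal R +
          (∫⁻ s in Set.Ioi R, 1 / μ (ball x s)) * μ (ball x R) := by
  intro R hR
  constructor
  · rw [setLIntegral_ball_lintegral_Ioi_dist μ x hpos hfin ENNReal.measurable_ofReal hR,
      setLIntegral_Ioc_zero_ofReal hR.le]
  · rw [setLIntegral_ball_lintegral_Ioi_dist μ x hpos hfin measurable_const hR]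
    simp
end

section
/- Let (X,d) be a complete separable metric space in which every pair of points is joined by a geodesic, i.e. for all x, y ∈ X there exists γ : [0,1] → X with γ(0) = x, γ(1) = y and d(γ(s),γ(t)) = |s−t|·d(x,y) for all s, t ∈ [0,1]. Let μ be a Borel measure on X with 0 < μ(B(x,r)) < ∞ for every x ∈ X and r > 0, which is doubling with constant C_D. Then every sphere is μ-negligible: μ({y ∈ X : d(x,y) = r}) = 0 for every x ∈ X and r > 0. -/
open MeasureTheory Metric Set
open scoped ENNReal

open Filter Topology

/-- A measure that is doubling on open balls is uniformly locally doubling. -/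
theorem isUnifLocDoublingMeasure_of_measure_ball_two_mul_le {X : Type*} [PseudoMetricSpace X]
    [MeasurableSpace X] {μ : Measure X} {C : ℝ}
    (h : ∀ (x : X) (r : ℝ), 0 < r → μ (ball x (2 * r)) ≤ ENNReal.ofReal C * μ (ball x r)) :
    IsUnifLocDoublingMeasure μ := by
  refine ⟨⟨C.toNNReal * C.toNNReal, ?_⟩⟩
  filter_upwards [self_mem_nhdsWithin] with ε hε x
  rw [mem_Ioi] at hε
  calc μ (closedBall x (2 * ε)) ≤ μ (ball x (2 * (2 * ε))) :=
        measure_mono (closedBall_subset_ball (by linarith))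
    _ ≤ ENNReal.ofReal C * (ENNReal.ofReal C * μ (ball x ε)) :=
        (h x (2 * ε) (by linarith)).trans (mul_le_mul_right (h x ε hε) _)
    _ ≤ ENNReal.ofReal C * (ENNReal.ofReal C * μ (closedBall x ε)) := by
        gcongr
        exact ball_subset_closedBall
    _ = _ := by rw [ENNReal.coe_mul, mul_assoc]; rfl

/-- If every point `y` of `S` can be approached by closed balls of radius `δ → 0`, centred within
`K * δ` of `y` and disjoint from `S`, then `S` is null for a uniformly locally doubling measure. -/
theorem measure_eq_zero_of_eventually_exists_disjoint_closedBall {X : Type*} [PseudoMetricSpace X]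
    [SecondCountableTopology X] [MeasurableSpace X] [BorelSpace X] {μ : Measure X}
    [IsUnifLocDoublingMeasure μ] [IsLocallyFiniteMeasure μ] {S : Set X} (hS : MeasurableSet S)
    (K : ℝ) (h : ∀ y ∈ S, ∀ᶠ δ in 𝓝[>] (0 : ℝ),
      ∃ w, y ∈ closedBall w (K * δ) ∧ Disjoint S (closedBall w δ)) :
    μ S = 0 := by
  rw [← Measure.restrict_eq_zero, ← ae_eq_bot, ← eventually_false_iff_eq_bot]
  filter_upwards [IsUnifLocDoublingMeasure.ae_tendsto_measure_inter_div μ S K,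
    ae_restrict_mem hS] with y hy hyS
  have hw : ∀ δ : ℝ, ∃ w, (∃ w, y ∈ closedBall w (K * δ) ∧ Disjoint S (closedBall w δ)) →
      y ∈ closedBall w (K * δ) ∧ Disjoint S (closedBall w δ) := fun δ => by
    by_cases hδ : ∃ w, y ∈ closedBall w (K * δ) ∧ Disjoint S (closedBall w δ)
    · exact hδ.imp fun _ hw _ => hw
    · exact ⟨y, fun hδ' => absurd hδ' hδ⟩
  choose w hw using hw
  have hlim := hy w id tendsto_id ((h y hyS).mono fun δ hδ => (hw δ hδ).1)
  refine zero_ne_one (tendsto_nhds_unique (tendsto_const_nhds.congr' ?_) hlim)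
  filter_upwards [h y hyS] with δ hδ
  simp [(hw δ hδ).2.inter_eq]

/-- On a complete separable geodesic metric space equipped with a doubling Borel measure
giving positive finite mass to balls, every sphere is negligible. -/
theorem stmt_16 {X : Type*} [MetricSpace X] [CompleteSpace X]
    [TopologicalSpace.SeparableSpace X] [MeasurableSpace X] [BorelSpace X]
    (μ : Measure X) (C_D : ℝ) (hC_D : 1 ≤ C_D)
    (hpos : ∀ (x : X) (r : ℝ), 0 < r → 0 < μ (ball x r))
    (hfin : ∀ (x : X) (r : ℝ), 0 < r → μ (ball x r) < ⊤)
    (hdoub : ∀ (x : X) (r : ℝ), 0 < r →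
      μ (ball x (2 * r)) ≤ ENNReal.ofReal C_D * μ (ball x r))
    (hgeo : ∀ x y : X, ∃ γ : ℝ → X, γ 0 = x ∧ γ 1 = y ∧
      ∀ s ∈ Set.Icc (0 : ℝ) 1, ∀ t ∈ Set.Icc (0 : ℝ) 1,
        dist (γ s) (γ t) = |s - t| * dist x y) :
    ∀ (x : X) (r : ℝ), 0 < r → μ {y : X | dist x y = r} = 0 := by
  intro x r hr
  have := isUnifLocDoublingMeasure_of_measure_ball_two_mul_le hdoub
  have := UniformSpace.secondCountable_of_separable X
  have : IsLocallyFiniteMeasure μ :=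
    ⟨fun y => ⟨ball y 1, ball_mem_nhds y one_pos, hfin y 1 one_pos⟩⟩
  have hS : MeasurableSet {y : X | dist x y = r} :=
    (isClosed_eq (by fun_prop) continuous_const).measurableSet
  refine measure_eq_zero_of_eventually_exists_disjoint_closedBall hS 2 fun y hy => ?_
  filter_upwards [Ioo_mem_nhdsGT (half_pos hr)] with δ hδ
  obtain ⟨hδ₀, hδr⟩ := hδ
  obtain ⟨γ, hγ₀, hγ₁, hγ⟩ := hgeo x y
  rw [mem_ofPred_eq] at hy
  rw [hy] at hγ
  have ht : 2 * δ / r ∈ Icc (0 : ℝ) 1 := ⟨by positivity, (div_le_one hr).2 (by linarith)⟩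
  have hs : 1 - 2 * δ / r ∈ Icc (0 : ℝ) 1 := ⟨by linarith [ht.2], by linarith [ht.1]⟩
  have hmul : 2 * δ / r * r = 2 * δ := div_mul_cancel₀ _ hr.ne'
  refine ⟨γ (1 - 2 * δ / r), ?_, Set.disjoint_left.2 fun z hz hzw => ?_⟩
  · have h := hγ 1 (by simp) _ hs
    rw [hγ₁, sub_sub_cancel, abs_of_nonneg ht.1, hmul] at h
    exact mem_closedBall.2 h.le
  · have h := hγ 0 (by simp) _ hs
    rw [hγ₀, zero_sub, abs_neg, abs_of_nonneg hs.1, sub_mul, hmul, one_mul] at h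
    rw [mem_ofPred_eq] at hz
    linarith [dist_triangle_right x z (γ (1 - 2 * δ / r)), mem_closedBall.1 hzw]
end

section
/- Let (X,d) be a metric space and μ a Borel measure on X with 0 < μ(B(x,r)) < ∞ for every x ∈ X and r > 0. Fix x ∈ X and assume that F(x,r) < ∞ for every r > 0 and that lim_{r→0⁺} F(x,r) = ∞ (which holds, for instance, if there exist K > 0 and k > 2 with μ(B(x,s)) ≤ K·s^k for all small s). Let G be a function on {(x,y) : y ≠ x} with values in (0,∞) satisfying C₂⁻¹·F(x,d(x,y)) ≤ G(x,y) ≤ C₂·F(x,d(x,y)) for all y ≠ x and some constant C₂ ≥ 1. Then for every sequence (yₙ) in X with yₙ ≠ x for all n, one has G(x,yₙ) → ∞ as n → ∞ if and only if d(x,yₙ) → 0 as n → ∞. -/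
open MeasureTheory Metric Set Filter Topology
open scoped ENNReal

/-- An antitone function which is finite on `(0, ∞)` and blows up at `0⁺` tends to `⊤` along a
positive function exactly when that function tends to `0`. -/
theorem tendsto_top_comp_iff_tendsto_zero {ι : Type*} {l : Filter ι} {F : ℝ → ℝ≥0∞}
    (hanti : Antitone F) (hfin : ∀ r, 0 < r → F r < ⊤) (htop : Tendsto F (𝓝[>] 0) (𝓝 ⊤))
    {u : ι → ℝ} (hu : ∀ i, 0 < u i) :
    Tendsto (fun i => F (u i)) l (𝓝 ⊤) ↔ Tendsto u l (𝓝 0) := by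
  refine ⟨fun h => ?_, fun h => ?_⟩
  · refine tendsto_order.2 ⟨fun a ha => .of_forall fun i => ha.trans (hu i), fun r hr => ?_⟩
    filter_upwards [h.eventually (lt_mem_nhds (hfin r hr))] with i hi
    exact hanti.reflect_lt hi
  · exact htop.comp (tendsto_nhdsWithin_iff.2 ⟨h, .of_forall hu⟩)

/-- If `b` bounds `a` up to a finite constant factor, then `b` tends to `⊤` whenever `a` does. -/
theorem ENNReal.tendsto_top_of_le_const_mul {ι : Type*} {l : Filter ι} {a b : ι → ℝ≥0∞} {c : ℝ≥0∞}
    (hc : c ≠ ⊤) (hab : ∀ i, a i ≤ c * b i) (ha : Tendsto a l (𝓝 ⊤)) :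
    Tendsto b l (𝓝 ⊤) := by
  refine tendsto_order.2 ⟨fun M hM => ?_, fun M hM => absurd hM not_top_lt⟩
  filter_upwards [ha.eventually (lt_mem_nhds (ENNReal.mul_lt_top hc.lt_top hM))] with i hi
  exact lt_of_mul_lt_mul_left' (hi.trans_le (hab i))

/-- If `F(x,·)` is finite and blows up at `0⁺`, and `g` is comparable to `F(x,d(x,·))`
with constant `C₂ ≥ 1` away from `x`, then for any sequence `yₙ ≠ x`:
`g(yₙ) → ∞` if and only if `d(x,yₙ) → 0`. -/
theorem stmt_18 {X : Type*} [MetricSpace X] [MeasurableSpace X] [BorelSpace X]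
    (μ : Measure X)
    (hpos : ∀ (x : X) (r : ℝ), 0 < r → 0 < μ (ball x r))
    (hfin : ∀ (x : X) (r : ℝ), 0 < r → μ (ball x r) < ⊤)
    (x : X)
    (hFfin : ∀ r : ℝ, 0 < r →
      (∫⁻ s in Set.Ioi r, ENNReal.ofReal s / μ (ball x s)) < ⊤)
    (hFtop : Tendsto
      (fun r : ℝ => ∫⁻ s in Set.Ioi r, ENNReal.ofReal s / μ (ball x s))
      (𝓝[>] 0) (𝓝 ⊤))
    (C₂ : ℝ) (hC₂ : 1 ≤ C₂) (g : X → ℝ)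
    (hgpos : ∀ y : X, y ≠ x → 0 < g y)
    (hglow : ∀ y : X, y ≠ x →
      ENNReal.ofReal C₂⁻¹ *
          (∫⁻ s in Set.Ioi (dist x y), ENNReal.ofReal s / μ (ball x s)) ≤
        ENNReal.ofReal (g y))
    (hgupp : ∀ y : X, y ≠ x →
      ENNReal.ofReal (g y) ≤
        ENNReal.ofReal C₂ *
          ∫⁻ s in Set.Ioi (dist x y), ENNReal.ofReal s / μ (ball x s)) :
    ∀ y : ℕ → X, (∀ n, y n ≠ x) →
      (Tendsto (fun n => g (y n)) atTop atTop ↔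
        Tendsto (fun n => dist x (y n)) atTop (𝓝 0)) := by
  intro y hy
  have hanti : Antitone fun r : ℝ => ∫⁻ s in Set.Ioi r, ENNReal.ofReal s / μ (ball x s) :=
    fun _ _ h => lintegral_mono_set (Ioi_subset_Ioi h)
  rw [← tendsto_top_comp_iff_tendsto_zero hanti hFfin hFtop fun n => dist_pos.2 (hy n).symm,
    ← ENNReal.tendsto_ofReal_nhds_top]
  have hC : 0 < C₂ := one_pos.trans_le hC₂
  refine ⟨ENNReal.tendsto_top_of_le_const_mul ENNReal.ofReal_ne_top fun n => hgupp _ (hy n),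
    ENNReal.tendsto_top_of_le_const_mul (c := ENNReal.ofReal C₂) ENNReal.ofReal_ne_top fun n => ?_⟩
  have h := hglow _ (hy n)
  rwa [ENNReal.ofReal_inv_of_pos hC, mul_comm, ← div_eq_mul_inv,
    ENNReal.div_le_iff' (ENNReal.ofReal_pos.2 hC).ne' ENNReal.ofReal_ne_top] at h
end
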